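/- (Domination theorem for viscosity subsolutions) For i = 1, …, k let u_i be upper semicontinuous on [0, T] × ℝᴺ and a viscosity subsolution of ∂_t u − G_i(t, x, u, Du, D²u) = 0 on (0, T) × ℝᴺ, and let β_1, …, β_k > 0 be constants such that (Σ_{i=1}^k β_i u_i(t, x))⁺ → 0 uniformly as |x| → ∞. Assume: (i) each G_i : [0, T] × ℝᴺ × ℝ × ℝᴺ × S(N) → ℝ is continuous and satisfies [G_i(t, x, v, p, X) − G_i(t, y, v, p, X)]⁻ ≤ ω̄(1 + (T − t)^{−1} + |x| + |y| + |v|) · ω(|x − y| + |p|·|x − y|) for continuous functions ω, ω̄ : ℝ⁺ → ℝ⁺ with ω(0) = 0; (ii) the domination condition: Σ_{i=1}^k β_i G_i(t, x, v_i, p_i, X_i) ≤ 0 whenever Σ_{i=1}^k β_i v_i ≥ 0, Σ_{i=1}^k β_i p_i = 0 and Σ_{i=1}^k β_i X_i ≤ 0. Then, if Σ_{i=1}^k β_i u_i(0, ·) is a non-positive continuous function on ℝᴺ, it follows that Σ_{i=1}^k β_i u_i(t, x) ≤ 0 for all t ∈ (0, T) and x ∈ ℝᴺ. -/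

import Mathlib

noncomputable section

open Real Set Filter

/-- `ℝᴺ` as a Euclidean space. -/
abbrev Euc (N : ℕ) := EuclideanSpace ℝ (Fin N)

/-- Time derivative `∂ₜψ` of a function on `ℝ × ℝᴺ`. -/
noncomputable def tderiv {N : ℕ} (ψ : ℝ × Euc N → ℝ) (q : ℝ × Euc N) : ℝ :=
  deriv (fun s => ψ (s, q.2)) q.1

/-- Spatial gradient `Dψ` of a function on `ℝ × ℝᴺ`. -/
noncomputable def xgrad {N : ℕ} (ψ : ℝ × Euc N → ℝ) (q : ℝ × Euc N) : Euc N :=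
  gradient (fun z => ψ (q.1, z)) q.2

/-- Spatial Hessian `D²ψ` (as a matrix) of a function on `ℝ × ℝᴺ`. -/
noncomputable def xhess {N : ℕ} (ψ : ℝ × Euc N → ℝ) (q : ℝ × Euc N) :
    Matrix (Fin N) (Fin N) ℝ :=
  fun i j => iteratedFDeriv ℝ 2 (fun z => ψ (q.1, z)) q.2
    ![EuclideanSpace.single i 1, EuclideanSpace.single j 1]

/-- `u` is a viscosity subsolution of `∂ₜu − G(t, x, u, Du, D²u) = 0` on `(0,T) × ℝᴺ`. -/
def IsViscSubsolFull {N : ℕ} (T : ℝ)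
    (G : ℝ → Euc N → ℝ → Euc N → Matrix (Fin N) (Fin N) ℝ → ℝ)
    (u : ℝ × Euc N → ℝ) : Prop :=
  ∀ ψ : ℝ × Euc N → ℝ, ContDiff ℝ 2 ψ →
    ∀ q : ℝ × Euc N, q.1 ∈ Set.Ioo 0 T →
    IsLocalMaxOn (fun z => u z - ψ z)
      (Set.Ioo (0 : ℝ) T ×ˢ (Set.univ : Set (Euc N))) q →
    tderiv ψ q - G q.1 q.2 (u q) (xgrad ψ q) (xhess ψ q) ≤ 0

section PartA
open Real Set Filter Topology
open scoped RealInnerProductSpace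

section Abs
variable {E : Type*} [NormedAddCommGroup E] [InnerProductSpace ℝ E]

lemma quad_lower (δ ε : ℝ) (hδ : 0 < δ) (hε : 0 < ε) (ξ ζ : E) :
    -(‖ξ‖ ^ 2 / (2 * ε)) ≤ ‖ξ - ζ‖ ^ 2 / (2 * δ) - ‖ζ‖ ^ 2 / (2 * (ε + δ)) := by
  have h : ‖ξ - ζ‖ ^ 2 / (2 * δ) - ‖ζ‖ ^ 2 / (2 * (ε + δ)) + ‖ξ‖ ^ 2 / (2 * ε)
      = ‖ε • ζ - (ε + δ) • ξ‖ ^ 2 / (2 * δ * (ε + δ) * ε) := by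
    rw [norm_sub_sq_real, norm_sub_sq_real, norm_smul, norm_smul, inner_smul_left,
      inner_smul_right, real_inner_comm ξ ζ]
    simp only [mul_pow, norm_eq_abs, sq_abs, conj_trivial]
    have : ε + δ ≠ 0 := by positivity
    field_simp
    ring
  have h2 : 0 ≤ ‖ε • ζ - (ε + δ) • ξ‖ ^ 2 / (2 * δ * (ε + δ) * ε) := by positivity
  linarith

lemma seg_sq (x z z' : E) (s : ℝ) :
    ‖x - (z + s • (z' - z))‖ ^ 2 =
      (1 - s) * ‖x - z‖ ^ 2 + s * ‖x - z'‖ ^ 2 - s * (1 - s) * ‖z' - z‖ ^ 2 := by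
  have e1 : x - (z + s • (z' - z)) = (x - z) - s • (z' - z) := by abel
  have e2 : x - z' = (x - z) - (z' - z) := by abel
  rw [e1, e2, norm_sub_sq_real (x - z), norm_sub_sq_real (x - z), norm_smul, inner_smul_right]
  simp only [mul_pow, norm_eq_abs, sq_abs]
  ring

lemma le_of_small {a b c : ℝ} (h : ∀ s : ℝ, 0 < s → s < 1 → a ≤ b + s * c) : a ≤ b := by
  have : Tendsto (fun s : ℝ => b + s * c) (𝓝[>] 0) (𝓝 (b + 0 * c)) := by
    apply Tendsto.mono_left _ nhdsWithin_le_nhds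
    apply Continuous.tendsto
    fun_prop
  rw [zero_mul, add_zero] at this
  refine ge_of_tendsto this ?_
  filter_upwards [Ioo_mem_nhdsGT (show (0:ℝ) < 1 by norm_num)] with s hs
  exact h s hs.1 hs.2

/-- Lasry-Lions regularisation. -/
lemma lasry_lions [FiniteDimensional ℝ E] {S : Set E} (hS : IsCompact S) (hne : S.Nonempty)
    {U : E → ℝ} (hU : UpperSemicontinuousOn U S) {δ ε : ℝ} (hδ : 0 < δ) (hε : 0 < ε) :
    ∃ (F : E → ℝ) (g : E → E),
      (∀ y y', F y' ≤ F y + ⟪g y, y' - y⟫ + ‖y' - y‖ ^ 2 / (2 * δ)) ∧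
      (∀ y y', F y + ⟪g y, y' - y⟫ - ‖y' - y‖ ^ 2 / (2 * ε) ≤ F y') ∧
      (∀ y, ∀ x ∈ S, U x - ‖x - y‖ ^ 2 / (2 * ε) ≤ F y) ∧
      (∀ y, ∃ x ∈ S, ∃ y', F y' = U x - ‖x - y'‖ ^ 2 / (2 * ε) ∧
        ∀ s ∈ Icc (0:ℝ) 1, F y + s * ⟪g y, y' - y⟫ + s ^ 2 * ‖y' - y‖ ^ 2 / (2 * δ) ≤
          F (y + s • (y' - y))) ∧
      (∀ y, ∃ x ∈ S, F y ≤ U x - ‖x - y‖ ^ 2 / (2 * (ε + δ))) := by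
  have hη : 0 < ε + δ := by positivity
  have hmax : ∀ z : E, ∃ x ∈ S, ∀ x' ∈ S, U x' - ‖x' - z‖ ^ 2 / (2 * (ε + δ)) ≤
      U x - ‖x - z‖ ^ 2 / (2 * (ε + δ)) := by
    intro z
    have hc : UpperSemicontinuousOn (fun x => U x + -(‖x - z‖ ^ 2 / (2 * (ε + δ)))) S := by
      apply hU.add
      apply ContinuousOn.upperSemicontinuousOn
      fun_prop
    obtain ⟨x, hx, hx'⟩ := hc.exists_isMaxOn hne hS
    exact ⟨x, hx, fun x' h' => by simpa [sub_eq_add_neg] using hx' h'⟩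
  choose X hXS hX using hmax
  set f : E → ℝ := fun z => U (X z) - ‖X z - z‖ ^ 2 / (2 * (ε + δ)) with hf
  have hfge : ∀ z, ∀ x ∈ S, U x - ‖x - z‖ ^ 2 / (2 * (ε + δ)) ≤ f z := fun z x hx => hX z x hx
  have hflsc : LowerSemicontinuous f := by
    intro z c hc
    have : Tendsto (fun z' => U (X z) - ‖X z - z'‖ ^ 2 / (2 * (ε + δ))) (𝓝 z) (𝓝 (f z)) := by
      apply Continuous.tendsto' _ _ _ rfl
      fun_prop
    filter_upwards [this.eventually (lt_mem_nhds hc)] with z' hz'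
    exact lt_of_lt_of_le hz' (hfge z' _ (hXS z))
  have hmin : ∀ y : E, ∃ z, ∀ z', f z + ‖y - z‖ ^ 2 / (2 * δ) ≤ f z' + ‖y - z'‖ ^ 2 / (2 * δ) := by
    intro y
    have hlsc : LowerSemicontinuous (fun z => f z + ‖y - z‖ ^ 2 / (2 * δ)) := by
      apply hflsc.add
      apply Continuous.lowerSemicontinuous
      fun_prop
    obtain ⟨x0, hx0⟩ := hne
    -- coercivity
    set κ : ℝ := 1 / (2 * δ) - 1 / (2 * (δ + ε / 2)) with hκ
    have hκpos : 0 < κ := by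
      rw [hκ, sub_pos]
      apply one_div_lt_one_div_of_lt <;> linarith
    have hco : ∀ z, U x0 - ‖x0 - y‖ ^ 2 / (2 * (ε / 2)) + κ * ‖y - z‖ ^ 2 ≤
        f z + ‖y - z‖ ^ 2 / (2 * δ) := by
      intro z
      have h1 := hfge z x0 hx0
      have h2 := quad_lower (δ + ε / 2) (ε / 2) (by positivity) (by positivity) (x0 - y) (x0 - z)
      have e : x0 - y - (x0 - z) = -(y - z) := by abel
      rw [e, norm_neg, show ε / 2 + (δ + ε / 2) = ε + δ by ring] at h2
      have : κ * ‖y - z‖ ^ 2 = ‖y - z‖ ^ 2 / (2 * δ) - ‖y - z‖ ^ 2 / (2 * (δ + ε / 2)) := by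
        rw [hκ]; ring
      linarith
    set ρ : ℝ := 1 + max ((f y - (U x0 - ‖x0 - y‖ ^ 2 / (2 * (ε / 2)))) / κ) 0 with hρ
    have hρ1 : 1 ≤ ρ := by rw [hρ]; linarith [le_max_right ((f y - (U x0 - ‖x0 - y‖ ^ 2 / (2 * (ε / 2)))) / κ) 0]
    obtain ⟨z, hz, hz'⟩ := (hlsc.lowerSemicontinuousOn (Metric.closedBall y ρ)).exists_isMinOn
      ⟨y, Metric.mem_closedBall_self (by linarith)⟩ (isCompact_closedBall y ρ)
    refine ⟨z, fun z' => ?_⟩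
    by_cases hzz : z' ∈ Metric.closedBall y ρ
    · exact hz' hzz
    · have h1 := hz' (Metric.mem_closedBall_self (x := y) (by linarith : (0:ℝ) ≤ ρ))
      simp only [mem_ofPred_eq, sub_self, norm_zero] at h1
      rw [Metric.mem_closedBall, dist_comm, dist_eq_norm, not_le] at hzz
      have h2 := hco z'
      have h3 : ρ ≤ ‖y - z'‖ ^ 2 := by nlinarith
      have h4 : (f y - (U x0 - ‖x0 - y‖ ^ 2 / (2 * (ε / 2)))) ≤ κ * ρ := by
        rw [mul_comm κ ρ, ← div_le_iff₀ hκpos, hρ]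
        linarith [le_max_left ((f y - (U x0 - ‖x0 - y‖ ^ 2 / (2 * (ε / 2)))) / κ) 0]
      have h5 : κ * ρ ≤ κ * ‖y - z'‖ ^ 2 := by gcongr
      have : (0:ℝ) ^ 2 / (2 * δ) = 0 := by simp
      linarith
  choose Z hZ using hmin
  set F : E → ℝ := fun y => f (Z y) + ‖y - Z y‖ ^ 2 / (2 * δ) with hF
  have hFle : ∀ y z', F y ≤ f z' + ‖y - z'‖ ^ 2 / (2 * δ) := hZ
  set g : E → E := fun y => (1 / δ) • (y - Z y) with hg
  have hexp : ∀ y y', ‖y' - Z y‖ ^ 2 / (2 * δ) =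
      ‖y - Z y‖ ^ 2 / (2 * δ) + ⟪g y, y' - y⟫ + ‖y' - y‖ ^ 2 / (2 * δ) := by
    intro y y'
    have : y' - Z y = (y - Z y) + (y' - y) := by abel
    rw [this, norm_add_sq_real, hg]
    simp only [inner_smul_left, conj_trivial]
    field_simp
  have hc : ∀ y, ∀ x ∈ S, U x - ‖x - y‖ ^ 2 / (2 * ε) ≤ F y := by
    intro y x hx
    have h1 := hfge (Z y) x hx
    have h2 := quad_lower δ ε hδ hε (x - y) (x - Z y)
    have e : x - y - (x - Z y) = -(y - Z y) := by abel
    rw [e, norm_neg] at h2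
    have : F y = f (Z y) + ‖y - Z y‖ ^ 2 / (2 * δ) := rfl
    linarith
  have ha : ∀ y y', F y' ≤ F y + ⟪g y, y' - y⟫ + ‖y' - y‖ ^ 2 / (2 * δ) := by
    intro y y'
    have h1 := hFle y' (Z y)
    have : F y = f (Z y) + ‖y - Z y‖ ^ 2 / (2 * δ) := rfl
    rw [hexp y y'] at h1
    linarith
  refine ⟨F, g, ha, ?_, hc, ?_, ?_⟩
  · intro y y'
    have hsub : ∀ z', f (Z y) + ⟪g y, z' - Z y⟫ - ‖z' - Z y‖ ^ 2 / (2 * (ε + δ)) ≤ f z' := by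
      intro z'
      have key : ∀ s : ℝ, 0 < s → s < 1 →
          f (Z y) + ⟪g y, z' - Z y⟫ - ‖z' - Z y‖ ^ 2 / (2 * (ε + δ)) ≤
            f z' + s * (‖z' - Z y‖ ^ 2 / (2 * δ)) := by
        intro s hs hs1
        set zs := Z y + s • (z' - Z y) with hzs
        have h1 := hfge (Z y) _ (hXS zs)
        have h2 := hfge z' _ (hXS zs)
        have h3 : f zs = U (X zs) - ‖X zs - zs‖ ^ 2 / (2 * (ε + δ)) := rfl
        have h4 := hFle y zs
        have h5 : F y = f (Z y) + ‖y - Z y‖ ^ 2 / (2 * δ) := rfl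
        have h6 := seg_sq (X zs) (Z y) z' s
        rw [← hzs] at h6
        have h7 : ‖y - zs‖ ^ 2 / (2 * δ) = ‖y - Z y‖ ^ 2 / (2 * δ) - s * ⟪g y, z' - Z y⟫
            + s ^ 2 * (‖z' - Z y‖ ^ 2 / (2 * δ)) := by
          have e1 : y - zs = (y - Z y) - s • (z' - Z y) := by rw [hzs]; abel
          rw [e1, norm_sub_sq_real, norm_smul, inner_smul_right, hg]
          simp only [mul_pow, norm_eq_abs, sq_abs, inner_smul_left, conj_trivial]
          field_simp
        have h8 : f zs ≤ (1 - s) * f (Z y) + s * f z' +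
            s * (1 - s) * (‖z' - Z y‖ ^ 2 / (2 * (ε + δ))) := by
          rw [h3, h6]
          have h1' := mul_le_mul_of_nonneg_left h1 (by linarith : 0 ≤ 1 - s)
          have h2' := mul_le_mul_of_nonneg_left h2 hs.le
          have : ((1 - s) * ‖X zs - Z y‖ ^ 2 + s * ‖X zs - z'‖ ^ 2
              - s * (1 - s) * ‖z' - Z y‖ ^ 2) / (2 * (ε + δ))
            = (1 - s) * (‖X zs - Z y‖ ^ 2 / (2 * (ε + δ)))
              + s * (‖X zs - z'‖ ^ 2 / (2 * (ε + δ)))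
              - s * (1 - s) * (‖z' - Z y‖ ^ 2 / (2 * (ε + δ))) := by ring
          rw [this]
          linarith
        have h9 : 0 ≤ ‖z' - Z y‖ ^ 2 / (2 * (ε + δ)) := by positivity
        rw [h7] at h4
        have h10 : s * (f (Z y) + ⟪g y, z' - Z y⟫ - ‖z' - Z y‖ ^ 2 / (2 * (ε + δ))) ≤
            s * (f z' + s * (‖z' - Z y‖ ^ 2 / (2 * δ))) := by
          nlinarith [mul_nonneg (mul_pos hs hs).le h9]
        exact le_of_mul_le_mul_left h10 hs
      exact le_of_small key
    have h1 := hsub (Z y')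
    have h2 := quad_lower δ ε hδ hε (y' - y) (Z y' - Z y)
    have h3 : F y = f (Z y) + ‖y - Z y‖ ^ 2 / (2 * δ) := rfl
    have h4 : F y' = f (Z y') + ‖y' - Z y'‖ ^ 2 / (2 * δ) := rfl
    have h5 : ‖y' - Z y'‖ ^ 2 / (2 * δ) = ‖y' - y - (Z y' - Z y)‖ ^ 2 / (2 * δ)
        + ⟪g y, (y' - y) - (Z y' - Z y)⟫ + ‖y - Z y‖ ^ 2 / (2 * δ) := by
      have e1 : y' - Z y' = (y - Z y) + (y' - y - (Z y' - Z y)) := by abel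
      rw [e1, norm_add_sq_real, hg]
      simp only [inner_smul_left, conj_trivial]
      field_simp
      ring
    rw [inner_sub_right] at h5
    linarith
  · intro y
    set x := X (Z y) with hx
    set y' : E := Z y + (δ / (ε + δ)) • (x - Z y) with hy'
    have hfz : f (Z y) = U x - ‖x - Z y‖ ^ 2 / (2 * (ε + δ)) := rfl
    have e1 : y' - Z y = (δ / (ε + δ)) • (x - Z y) := by rw [hy']; abel
    have e2 : x - y' = (ε / (ε + δ)) • (x - Z y) := by
      have : (ε / (ε + δ)) = 1 - δ / (ε + δ) := by field_simp; ring
      rw [hy', this, sub_smul, one_smul]; abel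
    have e3 : U x - ‖x - y'‖ ^ 2 / (2 * ε) = f (Z y) + ‖y' - Z y‖ ^ 2 / (2 * δ) := by
      rw [hfz, e1, e2, norm_smul, norm_smul]
      simp only [mul_pow, norm_eq_abs, sq_abs]
      field_simp
      ring
    have h1 := hc y' x (hXS _)
    have h2 := hFle y' (Z y)
    have h3 : F y' = U x - ‖x - y'‖ ^ 2 / (2 * ε) := by linarith
    refine ⟨x, hXS _, y', h3, ?_⟩
    intro s hs
    set ys := y + s • (y' - y) with hys
    have h4 := hFle y (Z ys)
    have h5 := hFle y' (Z ys)
    have h6 : F ys = f (Z ys) + ‖ys - Z ys‖ ^ 2 / (2 * δ) := rfl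
    have h7 := seg_sq (Z ys) y y' s
    rw [← hys, norm_sub_rev _ ys, norm_sub_rev _ y, norm_sub_rev _ y'] at h7
    have h8 : F y' = F y + ⟪g y, y' - y⟫ + ‖y' - y‖ ^ 2 / (2 * δ) := by
      rw [h3, e3, hexp y y']
      ring
    have h4' := mul_le_mul_of_nonneg_left h4 (by linarith [hs.2] : 0 ≤ 1 - s)
    have h5' := mul_le_mul_of_nonneg_left h5 hs.1
    rw [h8] at h5'
    rw [h6, h7]
    have : ((1 - s) * ‖y - Z ys‖ ^ 2 + s * ‖y' - Z ys‖ ^ 2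
              - s * (1 - s) * ‖y' - y‖ ^ 2) / (2 * δ)
            = (1 - s) * (‖y - Z ys‖ ^ 2 / (2 * δ))
              + s * (‖y' - Z ys‖ ^ 2 / (2 * δ))
              - s * (1 - s) * (‖y' - y‖ ^ 2 / (2 * δ)) := by ring
    rw [this]
    have e9 : s ^ 2 * ‖y' - y‖ ^ 2 / (2 * δ) = s ^ 2 * (‖y' - y‖ ^ 2 / (2 * δ)) := by ring
    rw [e9]
    linarith
  · intro y
    refine ⟨X y, hXS y, ?_⟩
    have h := hFle y y
    simpa using h

end Abs
end PartA

section PartB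
open Real Set Filter Topology
open scoped RealInnerProductSpace

section Abs
variable {E : Type*} [NormedAddCommGroup E] [InnerProductSpace ℝ E]

lemma grad_hasFDerivAt {F : E → ℝ} {g : E → E} {C : ℝ}
    (h : ∀ y y', |F y' - F y - ⟪g y, y' - y⟫| ≤ C * ‖y' - y‖ ^ 2) (y : E) :
    HasFDerivAt F (innerSL ℝ (g y)) y := by
  rw [hasFDerivAt_iff_isLittleO]
  have h1 : (fun x' => F x' - F y - innerSL ℝ (g y) (x' - y)) =O[𝓝 y]
      (fun x' => ‖x' - y‖ ^ 2) := by
    apply Asymptotics.IsBigO.of_bound C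
    filter_upwards with x'
    simpa using h y x'
  refine h1.trans_isLittleO ?_
  have h2 := (Asymptotics.isLittleO_norm_pow_id (E' := E) (n := 2) (by norm_num)).comp_tendsto
    (show Tendsto (fun x' => x' - y) (𝓝 y) (𝓝 0) from
      Continuous.tendsto' (by fun_prop) _ _ (sub_self y))
  exact h2

lemma grad_lipschitz {F : E → ℝ} {g : E → E} {C : ℝ}
    (h : ∀ y y', |F y' - F y - ⟪g y, y' - y⟫| ≤ C * ‖y' - y‖ ^ 2) (y y' : E) :
    ‖g y' - g y‖ ≤ 6 * C * ‖y' - y‖ := by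
  rcases eq_or_ne (g y' - g y) 0 with h0 | h0
  · rw [h0, norm_zero]
    rcases eq_or_ne (y' - y) 0 with h1 | h1
    · simp [h1]
    · have h2 := (abs_nonneg _).trans (h y y')
      have h3 : 0 < ‖y' - y‖ := norm_pos_iff.2 h1
      have : 0 ≤ C := by
        by_contra hC
        push Not at hC
        nlinarith [mul_pos h3 h3]
      positivity
  · have hn : 0 < ‖g y' - g y‖ := norm_pos_iff.2 h0
    set r := ‖y' - y‖ with hr
    set w : E := (r / ‖g y' - g y‖) • (g y' - g y) with hw
    have hwn : ‖w‖ = r := by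
      rw [hw, norm_smul, norm_div, norm_norm, norm_norm]
      field_simp
      exact hr.symm
    have h1 := abs_le.1 (h y (y' + w))
    have h2 := abs_le.1 (h y' (y' + w))
    have h3 := abs_le.1 (h y y')
    have e1 : y' + w - y = (y' - y) + w := by abel
    have e2 : y' + w - y' = w := by abel
    rw [e1, inner_add_right] at h1
    rw [e2, hwn] at h2
    have hw2 : ⟪g y' - g y, w⟫ = r * ‖g y' - g y‖ := by
      rw [hw, inner_smul_right, real_inner_self_eq_norm_sq]
      field_simp
    rw [inner_sub_left] at hw2
    have hr0 : 0 ≤ r := norm_nonneg _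
    rcases hr0.eq_or_lt with hr0 | hr0
    · exfalso
      have : y' = y := sub_eq_zero.1 (norm_eq_zero.1 (hr.symm.trans hr0.symm))
      apply h0; rw [this, sub_self]
    have hC : 0 ≤ C := by
      have h2 := (abs_nonneg _).trans (h y y')
      by_contra hC
      push Not at hC
      nlinarith [mul_pos hr0 hr0]
    have h4 : ‖y' - y + w‖ ^ 2 ≤ 4 * r ^ 2 := by
      have := norm_add_le (y' - y) w
      rw [hwn, ← hr] at this
      nlinarith [norm_nonneg (y' - y + w)]
    have h5 : C * ‖y' - y + w‖ ^ 2 ≤ C * (4 * r ^ 2) := by gcongr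
    have h6 : r * ‖g y' - g y‖ ≤ r * (6 * C * r) := by nlinarith
    exact le_of_mul_le_mul_left h6 hr0

lemma taylor2 {F : E → ℝ} {g : E → E} {A : E →L[ℝ] E} {y : E}
    (hF : ∀ y, HasFDerivAt F (innerSL ℝ (g y)) y) (hg : HasFDerivAt g A y)
    {η : ℝ} (hη : 0 < η) :
    ∀ᶠ ξ in 𝓝 (0 : E), |F (y + ξ) - F y - ⟪g y, ξ⟫ - 1 / 2 * ⟪A ξ, ξ⟫| ≤ η * ‖ξ‖ ^ 2 := by
  have h1 := hasFDerivAt_iff_isLittleO_nhds_zero.1 hg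
  have h2 := h1.def hη
  obtain ⟨ρ, hρ, hb⟩ := Metric.eventually_nhds_iff_ball.1 h2
  rw [Metric.eventually_nhds_iff_ball]
  refine ⟨ρ, hρ, fun ξ hξ => ?_⟩
  set φ : ℝ → ℝ := fun s => F (y + s • ξ) - s * ⟪g y, ξ⟫ - s ^ 2 / 2 * ⟪A ξ, ξ⟫ with hφ
  have hd : ∀ s : ℝ, HasDerivAt φ (⟪g (y + s • ξ), ξ⟫ - ⟪g y, ξ⟫ - s * ⟪A ξ, ξ⟫) s := by
    intro s
    have hl : HasDerivAt (fun s : ℝ => y + s • ξ) ξ s := by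
      simpa using ((hasDerivAt_id s).smul_const ξ).const_add y
    have h3 : HasDerivAt (fun s : ℝ => F (y + s • ξ)) (⟪g (y + s • ξ), ξ⟫) s := by
      exact (hF (y + s • ξ)).comp_hasDerivAt s hl
    have h4 : HasDerivAt (fun s : ℝ => s * ⟪g y, ξ⟫) (⟪g y, ξ⟫) s := by
      simpa using (hasDerivAt_id s).mul_const (⟪g y, ξ⟫)
    have h5 : HasDerivAt (fun s : ℝ => s ^ 2 / 2 * ⟪A ξ, ξ⟫) (s * ⟪A ξ, ξ⟫) s := by
      have := (((hasDerivAt_id s).pow 2).div_const 2).mul_const (⟪A ξ, ξ⟫)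
      refine this.congr_deriv ?_
      simp
    exact (h3.sub h4).sub h5
  have hbd : ∀ s ∈ Icc (0:ℝ) 1, ‖⟪g (y + s • ξ), ξ⟫ - ⟪g y, ξ⟫ - s * ⟪A ξ, ξ⟫‖ ≤ η * ‖ξ‖ ^ 2 := by
    intro s hs
    have hmem : s • ξ ∈ Metric.ball (0:E) ρ := by
      rw [mem_ball_zero_iff] at hξ ⊢
      rw [norm_smul, norm_of_nonneg hs.1]
      nlinarith [norm_nonneg ξ, hs.2]
    have h3 := hb _ hmem
    have e : ⟪g (y + s • ξ), ξ⟫ - ⟪g y, ξ⟫ - s * ⟪A ξ, ξ⟫ =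
        ⟪g (y + s • ξ) - g y - A (s • ξ), ξ⟫ := by
      rw [inner_sub_left, inner_sub_left, map_smul, inner_smul_left]; simp
    rw [e]
    refine (norm_inner_le_norm _ _).trans ?_
    rw [norm_smul, norm_of_nonneg hs.1] at h3
    calc _ ≤ (η * (s * ‖ξ‖)) * ‖ξ‖ := by gcongr
      _ = s * (η * ‖ξ‖ ^ 2) := by ring
      _ ≤ 1 * (η * ‖ξ‖ ^ 2) := by gcongr; exact hs.2
      _ = _ := one_mul _
  have := (convex_Icc (0:ℝ) 1).norm_image_sub_le_of_norm_hasDerivWithin_le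
    (fun s _ => (hd s).hasDerivWithinAt) hbd (left_mem_Icc.2 zero_le_one)
    (right_mem_Icc.2 zero_le_one)
  simp only [hφ, norm_eq_abs] at this
  simp at this
  have e : F (y + ξ) - F y - ⟪g y, ξ⟫ - 1 / 2 * ⟪A ξ, ξ⟫ =
    F (y + ξ) - ⟪g y, ξ⟫ - 2⁻¹ * ⟪A ξ, ξ⟫ - F y := by ring
  rw [e]; exact this

lemma taylor2_dir {F : E → ℝ} {g : E → E} {A : E →L[ℝ] E} {y : E}
    (hF : ∀ y, HasFDerivAt F (innerSL ℝ (g y)) y) (hg : HasFDerivAt g A y)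
    (v : E) {η : ℝ} (hη : 0 < η) :
    ∃ s : ℝ, 0 < s ∧ s < 1 ∧
      |F (y + s • v) - F y - s * ⟪g y, v⟫ - s ^ 2 / 2 * ⟪A v, v⟫| ≤ η * s ^ 2 := by
  have h1 := taylor2 hF hg (η := η / (‖v‖ ^ 2 + 1)) (by positivity)
  have h2 : Tendsto (fun s : ℝ => s • v) (𝓝[>] 0) (𝓝 0) := by
    apply Tendsto.mono_left _ nhdsWithin_le_nhds
    exact Continuous.tendsto' (by fun_prop) _ _ (zero_smul ℝ v)
  obtain ⟨s, hs, hs1⟩ := ((h2.eventually h1).and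
    (Ioo_mem_nhdsGT (show (0:ℝ) < 1 by norm_num))).exists
  refine ⟨s, hs1.1, hs1.2, ?_⟩
  rw [map_smul, inner_smul_left, inner_smul_right, inner_smul_right, norm_smul, mul_pow] at hs
  simp only [conj_trivial, norm_eq_abs, sq_abs] at hs
  have e : F (y + s • v) - F y - s * ⟪g y, v⟫ - s ^ 2 / 2 * ⟪A v, v⟫ =
    F (y + s • v) - F y - s * ⟪g y, v⟫ - 1 / 2 * (s * (s * ⟪A v, v⟫)) := by ring
  rw [e]
  refine hs.trans ?_
  rw [div_mul_eq_mul_div, div_le_iff₀ (by positivity)]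
  nlinarith [mul_pos hη (mul_pos hs1.1 hs1.1)]

lemma hess_le {F : E → ℝ} {g : E → E} {A : E →L[ℝ] E} {y : E}
    (hF : ∀ y, HasFDerivAt F (innerSL ℝ (g y)) y) (hg : HasFDerivAt g A y) (v : E) (c : ℝ)
    (h : ∀ s : ℝ, 0 < s → s < 1 → F (y + s • v) ≤ F y + s * ⟪g y, v⟫ + s ^ 2 * c) :
    ⟪A v, v⟫ ≤ 2 * c := by
  apply le_of_forall_pos_le_add
  intro η hη
  obtain ⟨s, hs, hs1, hs2⟩ := taylor2_dir hF hg v (half_pos hη)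
  have h1 := h s hs hs1
  have h2 := (abs_le.1 hs2).1
  have h3 : s ^ 2 * ⟪A v, v⟫ ≤ s ^ 2 * (2 * c + η) := by linarith
  exact le_of_mul_le_mul_left h3 (by positivity)

lemma le_hess {F : E → ℝ} {g : E → E} {A : E →L[ℝ] E} {y : E}
    (hF : ∀ y, HasFDerivAt F (innerSL ℝ (g y)) y) (hg : HasFDerivAt g A y) (v : E) (c : ℝ)
    (h : ∀ s : ℝ, 0 < s → s < 1 → F y + s * ⟪g y, v⟫ + s ^ 2 * c ≤ F (y + s • v)) :
    2 * c ≤ ⟪A v, v⟫ := by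
  apply le_of_forall_pos_le_add
  intro η hη
  obtain ⟨s, hs, hs1, hs2⟩ := taylor2_dir hF hg v (half_pos hη)
  have h1 := h s hs hs1
  have h2 := (abs_le.1 hs2).2
  have h3 : s ^ 2 * (2 * c) ≤ s ^ 2 * (⟪A v, v⟫ + η) := by linarith
  exact le_of_mul_le_mul_left h3 (by positivity)

lemma hess_symm {F : E → ℝ} {g : E → E} {A : E →L[ℝ] E} {y : E}
    (hF : ∀ y, HasFDerivAt F (innerSL ℝ (g y)) y) (hg : HasFDerivAt g A y) (v w : E) :
    ⟪A v, w⟫ = ⟪A w, v⟫ := by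
  have h1 : HasFDerivAt (fun y => innerSL ℝ (g y)) ((innerSL ℝ).comp A) y := by
    exact (innerSL ℝ (E := E)).hasFDerivAt.comp y hg
  have := second_derivative_symmetric hF h1 v w
  simpa using this

end Abs
end PartB

section PartC
open Real Set Filter Topology MeasureTheory
open scoped RealInnerProductSpace NNReal

section Abs
variable {E : Type*} [NormedAddCommGroup E] [InnerProductSpace ℝ E]

/-- A generic maximum point of a tilted `C^{1,1}` function where given Lipschitz maps are
differentiable. -/
lemma jensen_point [FiniteDimensional ℝ E] {ι : Type*} [Fintype ι] {W : E → ℝ} {gW : E → E}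
    {g : ι → E → E} {L : ℝ≥0} (hg : ∀ i, LipschitzWith L (g i)) {L' : ℝ≥0}
    (hgW : LipschitzWith L' gW)
    (hW : ∀ y, HasFDerivAt W (innerSL ℝ (gW y)) y)
    {C0 c : ℝ} (hc : 0 < c) (hgrow : ∀ y, W y ≤ C0 - c * ‖y‖ ^ 2) {r : ℝ} (hr : 0 < r) :
    ∃ y, ‖gW y‖ ≤ r ∧ (∀ y', W y' - ⟪gW y, y'⟫ ≤ W y - ⟪gW y, y⟫) ∧
      ∀ i, DifferentiableAt ℝ (g i) y := by
  let _ : MeasurableSpace E := borel E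
  have : BorelSpace E := ⟨rfl⟩
  let μ : Measure E := μH[Module.finrank ℝ E]
  have : μ.IsAddHaarMeasure := isAddHaarMeasure_hausdorffMeasure
  have hWc : Continuous W := continuous_iff_continuousAt.2 fun y => (hW y).continuousAt
  have hmax : ∀ p : E, ∃ y, gW y = p ∧ ∀ y', W y' - ⟪p, y'⟫ ≤ W y - ⟪p, y⟫ := by
    intro p
    have ht : Tendsto (fun y => W y - ⟪p, y⟫) (cocompact E) atBot := by
      have h1 : Tendsto (fun n : ℝ => C0 + n * (‖p‖ + (-c) * n)) atTop atBot := by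
        apply tendsto_atBot_add_const_left
        apply Tendsto.atTop_mul_atBot₀ tendsto_id
        apply tendsto_atBot_add_const_left
        exact tendsto_id.const_mul_atTop_of_neg (by linarith)
      refine tendsto_atBot_mono ?_ (h1.comp (tendsto_norm_cocompact_atTop (E := E)))
      intro y
      have h2 := hgrow y
      have h3 := (abs_le.1 (abs_real_inner_le_norm p y)).1
      simp only [Function.comp]
      nlinarith
    obtain ⟨y, hy⟩ := Continuous.exists_forall_ge (f := fun y => W y - ⟪p, y⟫)
      (by fun_prop) ht
    refine ⟨y, ?_, hy⟩
    have h2 : HasFDerivAt (fun y => W y - ⟪p, y⟫) (innerSL ℝ (gW y) - innerSL ℝ p) y :=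
      (hW y).sub (innerSL ℝ p).hasFDerivAt
    have h3 := IsLocalMax.hasFDerivAt_eq_zero (Filter.Eventually.of_forall hy) h2
    rw [sub_eq_zero] at h3
    exact ext_inner_right ℝ fun v => by simpa using DFunLike.congr_fun h3 v
  choose Y hY1 hY2 using hmax
  by_contra hcon
  push Not at hcon
  have hnull : μ {y | ¬ ∀ i, DifferentiableAt ℝ (g i) y} = 0 := by
    have : ∀ᵐ y ∂μ, ∀ i, DifferentiableAt ℝ (g i) y :=
      ae_all_iff.2 fun i => (hg i).ae_differentiableAt
    exact this
  have himg : μ (gW '' {y | ¬ ∀ i, DifferentiableAt ℝ (g i) y}) = 0 := by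
    have := hgW.hausdorffMeasure_image_le (d := Module.finrank ℝ E) (by positivity)
      {y | ¬ ∀ i, DifferentiableAt ℝ (g i) y}
    refine le_antisymm (this.trans ?_) bot_le
    rw [show μH[Module.finrank ℝ E] {y | ¬ ∀ i, DifferentiableAt ℝ (g i) y} = 0 from hnull]
    simp
  have hball : Metric.ball (0:E) r ⊆ gW '' {y | ¬ ∀ i, DifferentiableAt ℝ (g i) y} := by
    intro p hp
    refine ⟨Y p, ?_, hY1 p⟩
    intro hd
    obtain ⟨i, hi⟩ := hcon (Y p) (by rw [hY1]; exact (mem_ball_zero_iff.1 hp).le)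
      (by rw [hY1]; exact hY2 p)
    exact hi (hd i)
  have h0 : μ (Metric.ball (0:E) r) = 0 := measure_mono_null hball himg
  exact (Metric.measure_ball_pos μ 0 hr).ne' h0

theorem sum_lemma [FiniteDimensional ℝ E] {ι : Type*} [Fintype ι] [Nonempty ι]
    {β : ι → ℝ} (hβ : ∀ i, 0 < β i) {ε : ℝ} (hε : 0 < ε) :
    ∃ Λ : ℝ, ∀ (S : Set E) (U : ι → E → ℝ), IsCompact S → S.Nonempty →
      (∀ i, UpperSemicontinuousOn (U i) S) → ∀ r : ℝ, 0 < r →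
      ∃ (y : E) (x : ι → E) (A : ι → E →L[ℝ] E),
        (∀ i, x i ∈ S) ∧
        (∀ i v w, ⟪A i v, w⟫ = ⟪A i w, v⟫) ∧
        (∀ i, ‖A i‖ ≤ Λ) ∧
        (∀ v, ∑ i, β i * ⟪A i v, v⟫ ≤ 0) ∧
        (‖∑ i, β i • ((1 / ε) • (x i - y))‖ ≤ r) ∧
        (∀ q ∈ S, ∑ i, β i * U i q ≤
          ∑ i, β i * (U i (x i) - ‖x i - y‖ ^ 2 / (2 * ε)) + r * ‖q - y‖) ∧
        (∀ i, ∀ η : ℝ, 0 < η → ∀ᶠ x' in 𝓝 (x i), x' ∈ S →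
          U i x' ≤ U i (x i) + ⟪(1 / ε) • (x i - y), x' - x i⟫ +
            1 / 2 * ⟪A i (x' - x i), x' - x i⟫ + η * ‖x' - x i‖ ^ 2) := by
  obtain ⟨i0, hi0⟩ := Finite.exists_min β
  set B : ℝ := ∑ i, β i with hB
  have hBpos : 0 < B := Finset.sum_pos (fun i _ => hβ i) Finset.univ_nonempty
  set δ : ℝ := ε * β i0 / (2 * B) with hδdef
  have hδ : 0 < δ := by have := hβ i0; positivity
  have hδB : ∀ i, δ * B < ε * β i := by
    intro i
    have h1 : δ * B = ε * β i0 / 2 := by rw [hδdef]; field_simp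
    have h2 := mul_le_mul_of_nonneg_left (hi0 i) hε.le
    have h3 := mul_pos hε (hβ i0)
    linarith
  set C : ℝ := 1 / (2 * δ) + 1 / (2 * ε) with hC
  have hCpos : 0 < C := by positivity
  refine ⟨6 * C, fun S U hS hne hU r hr => ?_⟩
  choose F g ha hb hc hd he using fun i => lasry_lions hS hne (hU i) hδ hε
  have hq : ∀ i y y', |F i y' - F i y - ⟪g i y, y' - y⟫| ≤ C * ‖y' - y‖ ^ 2 := by
    intro i y y'
    have h1 := ha i y y'
    have h2 := hb i y y'
    have e1 : C * ‖y' - y‖ ^ 2 = ‖y' - y‖ ^ 2 / (2 * δ) + ‖y' - y‖ ^ 2 / (2 * ε) := by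
      rw [hC]; ring
    have p1 : 0 ≤ ‖y' - y‖ ^ 2 / (2 * δ) := by positivity
    have p2 : 0 ≤ ‖y' - y‖ ^ 2 / (2 * ε) := by positivity
    rw [abs_le]
    constructor <;> linarith
  have hF : ∀ i y, HasFDerivAt (F i) (innerSL ℝ (g i y)) y := fun i => grad_hasFDerivAt (hq i)
  have hgl : ∀ i, LipschitzWith (Real.toNNReal (6 * C)) (g i) := by
    intro i
    apply LipschitzWith.of_dist_le_mul
    intro y y'
    rw [dist_eq_norm, dist_eq_norm, Real.coe_toNNReal _ (by positivity)]
    exact grad_lipschitz (hq i) y' y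
  set W : E → ℝ := fun y => ∑ i, β i * F i y with hW
  set gW : E → E := fun y => ∑ i, β i • g i y with hgW
  have hWd : ∀ y, HasFDerivAt W (innerSL ℝ (gW y)) y := by
    intro y
    have h1 : HasFDerivAt W (∑ i, β i • innerSL ℝ (g i y)) y :=
      HasFDerivAt.fun_sum fun i _ => (hF i y).const_mul (β i)
    have e : innerSL ℝ (gW y) = ∑ i, β i • innerSL ℝ (g i y) := by
      ext v
      simp [hgW, sum_inner, inner_smul_left]
    rw [e]; exact h1
  have hWq : ∀ y y', |W y' - W y - ⟪gW y, y' - y⟫| ≤ (B * C) * ‖y' - y‖ ^ 2 := by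
    intro y y'
    have e : W y' - W y - ⟪gW y, y' - y⟫ = ∑ i, β i * (F i y' - F i y - ⟪g i y, y' - y⟫) := by
      simp only [hW, hgW, sum_inner, inner_smul_left, conj_trivial, ← Finset.sum_sub_distrib]
      exact Finset.sum_congr rfl fun i _ => by ring
    rw [e, hB, mul_assoc, Finset.sum_mul]
    refine (Finset.abs_sum_le_sum_abs _ _).trans (Finset.sum_le_sum fun i _ => ?_)
    rw [abs_mul, abs_of_pos (hβ i)]
    exact mul_le_mul_of_nonneg_left (hq i y y') (hβ i).le
  have hgWl : LipschitzWith (Real.toNNReal (6 * (B * C))) gW := by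
    apply LipschitzWith.of_dist_le_mul
    intro y y'
    rw [dist_eq_norm, dist_eq_norm, Real.coe_toNNReal _ (by positivity)]
    exact grad_lipschitz hWq y' y
  have hgrow : ∃ C0 c : ℝ, 0 < c ∧ ∀ y, W y ≤ C0 - c * ‖y‖ ^ 2 := by
    obtain ⟨ρ, hρ⟩ := hS.isBounded.exists_norm_le
    have hm : ∀ i, ∃ M, ∀ x ∈ S, U i x ≤ M := by
      intro i
      obtain ⟨x, hx, hx'⟩ := (hU i).exists_isMaxOn hne hS
      exact ⟨U i x, fun x' h' => hx' h'⟩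
    choose M hM using hm
    set κ : ℝ := 1 / (2 * (ε + δ)) with hκ
    have hκp : 0 < κ := by positivity
    refine ⟨∑ i, β i * (M i + κ * ρ ^ 2), B * (κ / 2), by positivity, fun y => ?_⟩
    rw [hB, mul_assoc, Finset.sum_mul, ← Finset.sum_sub_distrib]
    refine Finset.sum_le_sum fun i _ => ?_
    rw [← mul_sub]
    refine mul_le_mul_of_nonneg_left ?_ (hβ i).le
    obtain ⟨x, hx, hx'⟩ := he i y
    have h1 := hM i x hx
    have h2 := hρ x hx
    have h3 : ‖y‖ ≤ ‖x - y‖ + ρ := by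
      have := norm_sub_norm_le y x
      rw [norm_sub_rev] at this
      linarith
    have h4 : ‖y‖ ^ 2 / 2 - ρ ^ 2 ≤ ‖x - y‖ ^ 2 := by
      have : 0 ≤ ρ := (norm_nonneg _).trans h2
      nlinarith [norm_nonneg y, norm_nonneg (x - y), sq_nonneg (‖x - y‖ - ρ)]
    have h5 : κ * (‖y‖ ^ 2 / 2 - ρ ^ 2) ≤ κ * ‖x - y‖ ^ 2 := by gcongr
    have h6 : ‖x - y‖ ^ 2 / (2 * (ε + δ)) = κ * ‖x - y‖ ^ 2 := by rw [hκ]; ring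
    rw [h6] at hx'
    linarith
  obtain ⟨C0, c, hcpos, hgrow⟩ := hgrow
  obtain ⟨y, hy1, hy2, hy3⟩ := jensen_point hgl hgWl hWd hcpos hgrow hr
  set A : ι → E →L[ℝ] E := fun i => fderiv ℝ (g i) y with hA
  have hAd : ∀ i, HasFDerivAt (g i) (A i) y := fun i => (hy3 i).hasFDerivAt
  have hWA : HasFDerivAt gW (∑ i, β i • A i) y :=
    HasFDerivAt.fun_sum fun i _ => (hAd i).const_smul (β i)
  have hAneg : ∀ v, ∑ i, β i * ⟪A i v, v⟫ ≤ 0 := by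
    intro v
    have := hess_le hWd hWA v 0 (fun s hs hs1 => by
      have := hy2 (y + s • v)
      rw [inner_add_right, inner_smul_right] at this
      linarith)
    simpa [sum_inner, inner_smul_left] using this
  have hAlow : ∀ i v, -(‖v‖ ^ 2 / ε) ≤ ⟪A i v, v⟫ := by
    intro i v
    have := le_hess (hF i) (hAd i) v (-(‖v‖ ^ 2 / (2 * ε))) (fun s hs hs1 => by
      have := hb i y (y + s • v)
      rw [add_sub_cancel_left, inner_smul_right, norm_smul, mul_pow, norm_eq_abs, sq_abs] at this
      have e : s ^ 2 * ‖v‖ ^ 2 / (2 * ε) = s ^ 2 * (‖v‖ ^ 2 / (2 * ε)) := by ring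
      linarith)
    have e : ‖v‖ ^ 2 / ε = 2 * (‖v‖ ^ 2 / (2 * ε)) := by field_simp
    linarith
  have hAup : ∀ i v, β i * ⟪A i v, v⟫ ≤ B * (‖v‖ ^ 2 / ε) := by
    intro i v
    have h1 := hAneg v
    have h2 : β i * (⟪A i v, v⟫ + ‖v‖ ^ 2 / ε) ≤ ∑ j, β j * (⟪A j v, v⟫ + ‖v‖ ^ 2 / ε) :=
      Finset.single_le_sum (f := fun j => β j * (⟪A j v, v⟫ + ‖v‖ ^ 2 / ε))
        (fun j _ => mul_nonneg (hβ j).le (by linarith [hAlow j v])) (Finset.mem_univ i)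
    simp only [mul_add, Finset.sum_add_distrib, ← Finset.sum_mul] at h2
    have h3 : 0 ≤ β i * (‖v‖ ^ 2 / ε) := by have := hβ i; positivity
    linarith
  -- contact
  have hcontact : ∀ i, ∃ x ∈ S, F i y = U i x - ‖x - y‖ ^ 2 / (2 * ε) := by
    intro i
    obtain ⟨x, hx, y', h1, h2⟩ := hd i y
    have h3 : 2 * (‖y' - y‖ ^ 2 / (2 * δ)) ≤ ⟪A i (y' - y), y' - y⟫ :=
      le_hess (hF i) (hAd i) (y' - y) _ (fun s hs hs1 => by
        have := h2 s ⟨hs.le, hs1.le⟩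
        rw [mul_div_assoc] at this
        exact this)
    have h4 := hAup i (y' - y)
    have h5 : y' = y := by
      by_contra hne'
      have h6 : 0 < ‖y' - y‖ := norm_pos_iff.2 (sub_ne_zero.2 hne')
      have h7 : β i * (2 * (‖y' - y‖ ^ 2 / (2 * δ))) ≤ B * (‖y' - y‖ ^ 2 / ε) :=
        (mul_le_mul_of_nonneg_left h3 (hβ i).le).trans h4
      have h8 : β i * (2 * (‖y' - y‖ ^ 2 / (2 * δ))) = (β i * ‖y' - y‖ ^ 2) / δ := by
        field_simp
      have h9 : B * (‖y' - y‖ ^ 2 / ε) = (B * ‖y' - y‖ ^ 2) / ε := by ring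
      rw [h8, h9, div_le_div_iff₀ hδ hε] at h7
      have h10 := hδB i
      nlinarith [mul_pos (sub_pos.2 h10) (mul_pos h6 h6)]
    rw [h5] at h1
    exact ⟨x, hx, h1⟩
  choose x hxS hx using hcontact
  have hP : ∀ i, g i y = (1 / ε) • (x i - y) := by
    intro i
    rw [← sub_eq_zero]
    set d := g i y - (1 / ε) • (x i - y) with hdd
    have key : ∀ s : ℝ, 0 < s → s < 1 → ‖d‖ ^ 2 ≤ 0 +
        s * (‖d‖ ^ 2 / (2 * δ) + ‖d‖ ^ 2 / (2 * ε)) := by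
      intro s hs hs1
      have h1 := ha i y (y + (-s) • d)
      have h2 := hc i (y + (-s) • d) (x i) (hxS i)
      rw [add_sub_cancel_left, norm_smul, mul_pow, norm_eq_abs, sq_abs, inner_smul_right] at h1
      have e1 : x i - (y + (-s) • d) = (x i - y) + s • d := by rw [neg_smul]; abel
      rw [e1, norm_add_sq_real, norm_smul, mul_pow, norm_eq_abs, sq_abs, inner_smul_right] at h2
      have h3 := hx i
      have h4 : ‖d‖ ^ 2 = ⟪g i y, d⟫ - (1 / ε) * ⟪x i - y, d⟫ := by
        rw [← real_inner_self_eq_norm_sq]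
        have e0 : ⟪d, d⟫ = ⟪g i y - (1 / ε) • (x i - y), d⟫ := rfl
        rw [e0, inner_sub_left, inner_smul_left, conj_trivial]
      have e2 : (‖x i - y‖ ^ 2 + 2 * (s * ⟪x i - y, d⟫) + s ^ 2 * ‖d‖ ^ 2) / (2 * ε) =
        ‖x i - y‖ ^ 2 / (2 * ε) + s * ((1 / ε) * ⟪x i - y, d⟫) + s * (s * (‖d‖ ^ 2 / (2 * ε))) := by
        field_simp
      rw [e2] at h2
      have e3 : (-s) ^ 2 * ‖d‖ ^ 2 / (2 * δ) = s * (s * (‖d‖ ^ 2 / (2 * δ))) := by ring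
      rw [e3] at h1
      have h5 : s * ‖d‖ ^ 2 ≤ s * (0 + s * (‖d‖ ^ 2 / (2 * δ) + ‖d‖ ^ 2 / (2 * ε))) := by
        have h4' : s * ‖d‖ ^ 2 = s * ⟪g i y, d⟫ - s * ((1 / ε) * ⟪x i - y, d⟫) := by
          rw [h4]; ring
        rw [h4', zero_add, mul_add, mul_add]
        linarith
      exact le_of_mul_le_mul_left h5 hs
    have h6 := le_of_small key
    have : ‖d‖ = 0 := by nlinarith [norm_nonneg d]
    exact norm_eq_zero.1 this
  have hgWe : gW y = ∑ i, β i • ((1 / ε) • (x i - y)) :=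
    Finset.sum_congr rfl fun i _ => by rw [hP]
  refine ⟨y, x, A, hxS, fun i => hess_symm (hF i) (hAd i), ?_, hAneg, hgWe ▸ hy1, ?_, ?_⟩
  · intro i
    have := (hAd i).le_of_lipschitz (hgl i)
    rwa [Real.coe_toNNReal _ (by positivity)] at this
  · intro q hq'
    have h1 : ∑ i, β i * U i q ≤ W q := Finset.sum_le_sum fun i _ =>
      mul_le_mul_of_nonneg_left (by simpa using hc i q q hq') (hβ i).le
    have h2 := hy2 q
    have h3 : W y = ∑ i, β i * (U i (x i) - ‖x i - y‖ ^ 2 / (2 * ε)) :=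
      Finset.sum_congr rfl fun i _ => by rw [hx]
    have h4 : ⟪gW y, q - y⟫ ≤ r * ‖q - y‖ :=
      (real_inner_le_norm _ _).trans (by gcongr)
    rw [inner_sub_right] at h4
    linarith
  · intro i η hη
    have h1 := taylor2 (hF i) (hAd i) hη
    have h2 : Tendsto (fun x' => x' - x i) (𝓝 (x i)) (𝓝 0) :=
      Continuous.tendsto' (by fun_prop) _ _ (sub_self _)
    filter_upwards [h2.eventually h1] with x' hx' hx'S
    have h3 := hc i (y + (x' - x i)) x' hx'S
    have e : x' - (y + (x' - x i)) = x i - y := by abel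
    rw [e] at h3
    have h4 := (abs_le.1 hx').2
    have h5 := hx i
    rw [← hP]
    linarith

end Abs
end PartC

section PartD
section Apply
open Real Set Filter Topology MeasureTheory
open scoped RealInnerProductSpace NNReal

theorem sum_lemma' {E : Type*} [NormedAddCommGroup E] [InnerProductSpace ℝ E]
    [FiniteDimensional ℝ E] {ι : Type*} [Fintype ι] [Nonempty ι]
    {β : ι → ℝ} (hβ : ∀ i, 0 < β i) {ε : ℝ} (hε : 0 < ε) :
    ∃ Λ : ℝ, ∀ (S : Set E) (U : ι → E → ℝ), IsCompact S → S.Nonempty →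
      (∀ i, UpperSemicontinuousOn (U i) S) → ∀ σ : ℝ, 0 < σ →
      ∃ (y : E) (x : ι → E) (A : ι → E →L[ℝ] E),
        (∀ i, x i ∈ S) ∧
        (∀ i v w, ⟪A i v, w⟫ = ⟪A i w, v⟫) ∧
        (∀ i, ‖A i‖ ≤ Λ) ∧
        (∀ v, ∑ i, β i * ⟪A i v, v⟫ ≤ 0) ∧
        (‖∑ i, β i • ((1 / ε) • (x i - y))‖ ≤ σ) ∧
        (∀ q ∈ S, ∑ i, β i * U i q + ∑ i, β i * (‖x i - y‖ ^ 2 / (4 * ε)) ≤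
          ∑ i, β i * U i (x i) + σ) ∧
        (∀ i, ∀ η : ℝ, 0 < η → ∀ᶠ x' in 𝓝 (x i), x' ∈ S →
          U i x' ≤ U i (x i) + ⟪(1 / ε) • (x i - y), x' - x i⟫ +
            1 / 2 * ⟪A i (x' - x i), x' - x i⟫ + η * ‖x' - x i‖ ^ 2) := by
  obtain ⟨Λ, hΛ⟩ := sum_lemma (E := E) hβ hε
  refine ⟨Λ, fun S U hS hne hU σ hσ => ?_⟩
  obtain ⟨i0⟩ := ‹Nonempty ι›
  obtain ⟨d0, hd0⟩ := hS.isBounded.exists_norm_le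
  set d : ℝ := 2 * max d0 0 with hd
  have hdn : 0 ≤ d := by positivity
  set r : ℝ := min σ (min (β i0 / (4 * ε)) (σ / (1 + d))) with hr
  have hβ0 := hβ i0
  have hrpos : 0 < r := by
    rw [hr]; refine lt_min hσ (lt_min ?_ ?_) <;> positivity
  have hr1 : r ≤ σ := min_le_left _ _
  have hr2 : r ≤ β i0 / (4 * ε) := (min_le_right _ _).trans (min_le_left _ _)
  have hr3 : r * (1 + d) ≤ σ := by
    rw [← le_div_iff₀ (by positivity)]
    exact (min_le_right _ _).trans (min_le_right _ _)
  obtain ⟨y, x, A, h1, h2, h3, h4, h5, h6, h7⟩ := hΛ S U hS hne hU r hrpos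
  refine ⟨y, x, A, h1, h2, h3, h4, h5.trans hr1, ?_, h7⟩
  intro q hq
  have k1 := h6 q hq
  have k2 : ‖q - y‖ ≤ d + ‖x i0 - y‖ := by
    have e : q - y = (q - x i0) + (x i0 - y) := by abel
    rw [e]
    refine (norm_add_le _ _).trans ?_
    have := norm_sub_le q (x i0)
    have a1 := (hd0 q hq).trans (le_max_left d0 0)
    have a2 := (hd0 _ (h1 i0)).trans (le_max_left d0 0)
    linarith
  have k3 : r * ‖q - y‖ ≤ σ + β i0 * (‖x i0 - y‖ ^ 2 / (4 * ε)) := by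
    have a1 : r * ‖q - y‖ ≤ r * (d + ‖x i0 - y‖) := by gcongr
    have a2 : ‖x i0 - y‖ ≤ 1 + ‖x i0 - y‖ ^ 2 := by nlinarith [sq_nonneg (‖x i0 - y‖ - 1), sq_nonneg (‖x i0 - y‖)]
    have a3 : r * ‖x i0 - y‖ ≤ r * (1 + ‖x i0 - y‖ ^ 2) := by gcongr
    have a4 : r * ‖x i0 - y‖ ^ 2 ≤ β i0 / (4 * ε) * ‖x i0 - y‖ ^ 2 := by gcongr
    have e : β i0 * (‖x i0 - y‖ ^ 2 / (4 * ε)) = β i0 / (4 * ε) * ‖x i0 - y‖ ^ 2 := by ring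
    rw [e]
    nlinarith
  have k4 : β i0 * (‖x i0 - y‖ ^ 2 / (4 * ε)) ≤ ∑ i, β i * (‖x i - y‖ ^ 2 / (4 * ε)) :=
    Finset.single_le_sum (f := fun i => β i * (‖x i - y‖ ^ 2 / (4 * ε)))
      (fun i _ => by have := hβ i; positivity) (Finset.mem_univ i0)
  have k5 : ∑ i, β i * (U i (x i) - ‖x i - y‖ ^ 2 / (2 * ε)) =
      ∑ i, β i * U i (x i) - 2 * ∑ i, β i * (‖x i - y‖ ^ 2 / (4 * ε)) := by
    rw [Finset.mul_sum, ← Finset.sum_sub_distrib]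
    refine Finset.sum_congr rfl fun i _ => ?_
    field_simp
    ring
  rw [k5] at k1
  linarith

lemma usc_diag {X : Type*} [PseudoMetricSpace X] {ι : Type*} [Fintype ι] [Nonempty ι]
    {β : ι → ℝ} (hβ : ∀ i, 0 < β i) {S D : Set X} (hD : IsCompact D) (hDS : D ⊆ S)
    {U : ι → X → ℝ} (hU : ∀ i, UpperSemicontinuousOn (U i) S) {m : ℝ}
    (hm : ∀ q ∈ D, ∑ i, β i * U i q ≤ m) {σ : ℝ} (hσ : 0 < σ) :
    ∃ ρ > 0, ∀ q ∈ D, ∀ Q : ι → X, (∀ i, Q i ∈ S) → (∀ i, dist (Q i) q < ρ) →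
      ∑ i, β i * U i (Q i) < m + σ := by
  set B : ℝ := ∑ i, β i with hB
  have hBpos : 0 < B := Finset.sum_pos (fun i _ => hβ i) Finset.univ_nonempty
  have hr : ∀ q : D, ∃ r > 0, ∀ x' ∈ Metric.ball (q : X) r, x' ∈ S → ∀ i,
      U i x' < U i q + σ / B := by
    intro q
    have h1 : ∀ᶠ x' in 𝓝[S] (q : X), ∀ i, U i x' < U i q + σ / B := by
      rw [eventually_all]
      intro i
      exact hU i q (hDS q.2) _ (by have : 0 < σ / B := by positivity
                                   linarith)
    rw [eventually_nhdsWithin_iff, Metric.eventually_nhds_iff_ball] at h1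
    exact h1
  choose r hr0 hr using hr
  obtain ⟨ρ, hρ, h⟩ := lebesgue_number_lemma_of_metric (c := fun q : D => Metric.ball (q : X) (r q))
    hD (fun q => Metric.isOpen_ball)
    (fun q hq => mem_iUnion.2 ⟨⟨q, hq⟩, Metric.mem_ball_self (hr0 _)⟩)
  refine ⟨ρ, hρ, fun q hq Q hQ hd => ?_⟩
  obtain ⟨q0, hq0⟩ := h q hq
  have h1 : ∑ i, β i * U i (Q i) < ∑ i, β i * (U i q0 + σ / B) := by
    apply Finset.sum_lt_sum_of_nonempty Finset.univ_nonempty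
    intro i _
    exact mul_lt_mul_of_pos_left (hr q0 _ (hq0 (hd i)) (hQ i) i) (hβ i)
  have h2 : ∑ i, β i * (U i q0 + σ / B) = ∑ i, β i * U i q0 + σ := by
    simp only [mul_add, Finset.sum_add_distrib, ← Finset.sum_mul]
    rw [← hB]; field_simp
  have := hm q0 q0.2
  linarith

lemma visc_apply {N : ℕ} {E : Type*} [NormedAddCommGroup E] [InnerProductSpace ℝ E]
    (J : ℝ × Euc N →L[ℝ] E) {A : E →L[ℝ] E} (hA : ∀ v w, ⟪A v, w⟫ = ⟪A w, v⟫) {P : E} {p : Euc N}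
    (hp : ∀ ξ, ⟪P, J (0, ξ)⟫ = ⟪p, ξ⟫) {b : ℝ → ℝ} (hb : ContDiff ℝ 2 b) {b' : ℝ} {T : ℝ}
    {G : ℝ → Euc N → ℝ → Euc N → Matrix (Fin N) (Fin N) ℝ → ℝ} {u : ℝ × Euc N → ℝ}
    (hsub : IsViscSubsolFull T G u) {t : ℝ} {x : Euc N} (ht : t ∈ Ioo 0 T)
    (hb' : HasDerivAt b b' t)
    (h : ∀ᶠ q in 𝓝 (t, x), u q - b q.1 ≤ u (t, x) - b t + ⟪P, J (q - (t, x))⟫ +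
      1 / 2 * ⟪A (J (q - (t, x))), J (q - (t, x))⟫) :
    b' + ⟪P, J (1, 0)⟫ ≤ G t x (u (t, x)) p
      (fun j k => ⟪A (J (0, EuclideanSpace.single j 1)), J (0, EuclideanSpace.single k 1)⟫) := by
  set ψ : ℝ × Euc N → ℝ := fun q => b q.1 + ⟪P, J (q - (t, x))⟫ +
      1 / 2 * ⟪A (J (q - (t, x))), J (q - (t, x))⟫ with hψ
  have hψc : ContDiff ℝ 2 ψ := by
    have h1 : ContDiff ℝ 2 (fun q : ℝ × Euc N => J (q - (t, x))) :=
      J.contDiff.comp (contDiff_id.sub contDiff_const)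
    have h2 : ContDiff ℝ 2 (fun q : ℝ × Euc N => A (J (q - (t, x)))) := A.contDiff.comp h1
    exact ((hb.comp contDiff_fst).add (contDiff_const.inner ℝ h1)).add
      (contDiff_const.mul (h2.inner ℝ h1))
  have hmax : IsLocalMaxOn (fun z => u z - ψ z) (Ioo (0:ℝ) T ×ˢ (univ : Set (Euc N))) (t, x) := by
    have : ∀ᶠ q in 𝓝 (t, x), u q - ψ q ≤ u (t, x) - ψ (t, x) := by
      filter_upwards [h] with q hq
      simp only [hψ, sub_self, map_zero, inner_zero_right]
      linarith
    exact this.filter_mono nhdsWithin_le_nhds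
  have key := hsub ψ hψc (t, x) ht hmax
  have e1 : tderiv ψ (t, x) = b' + ⟪P, J (1, 0)⟫ := by
    unfold tderiv
    apply HasDerivAt.deriv
    have e : (fun s => ψ (s, (t, x).2)) = fun s => b s + (s - t) * ⟪P, J (1, 0)⟫ +
        1 / 2 * (s - t) ^ 2 * ⟪A (J (1, 0)), J (1, 0)⟫ := by
      funext s
      have : ((s, x) - (t, x) : ℝ × Euc N) = (s - t) • ((1, 0) : ℝ × Euc N) := by
        ext <;> simp
      simp only [hψ, this, map_smul, inner_smul_left, inner_smul_right, conj_trivial]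
      ring
    rw [e]
    have h1 : HasDerivAt (fun s : ℝ => s - t) 1 t := (hasDerivAt_id t).sub_const t
    have h2 := (hb'.add (h1.mul_const (⟪P, J (1, 0)⟫))).add
      (((h1.pow 2).const_mul (1 / 2)).mul_const (⟪A (J (1, 0)), J (1, 0)⟫))
    refine h2.congr_deriv ?_
    simp
  set ι : Euc N →L[ℝ] E := J.comp (ContinuousLinearMap.inr ℝ ℝ (Euc N)) with hι
  have hιa : ∀ ξ, ι ξ = J (0, ξ) := fun ξ => rfl
  have e0 : (fun z => ψ ((t, x).1, z)) = fun z => b t + ⟪p, z - x⟫ +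
      1 / 2 * ⟪A (ι (z - x)), ι (z - x)⟫ := by
    funext z
    have : ((t, z) - (t, x) : ℝ × Euc N) = (0, z - x) := by ext <;> simp
    simp only [hψ, this, hp, hιa]
  -- the Hessian as a bilinear map
  set H : Euc N →L[ℝ] Euc N →L[ℝ] ℝ := ((innerSL ℝ (E := E)).bilinearComp (A.comp ι) ι) with hH
  have hHa : ∀ v w, H v w = ⟪A (ι v), ι w⟫ := fun v w => by
    simp [hH]
  have hd : ∀ z, HasFDerivAt (fun z => b t + ⟪p, z - x⟫ +
      1 / 2 * ⟪A (ι (z - x)), ι (z - x)⟫) (innerSL ℝ p + H (z - x)) z := by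
    intro z
    have h0 : HasFDerivAt (fun z : Euc N => z - x) (ContinuousLinearMap.id ℝ _) z :=
      (hasFDerivAt_id z).sub_const x
    have h1 : HasFDerivAt (fun z => ι (z - x)) ι z := ι.hasFDerivAt.comp z h0
    have h2 : HasFDerivAt (fun z => A (ι (z - x))) (A.comp ι) z := A.hasFDerivAt.comp z h1
    have h3 := ((innerSL ℝ p).hasFDerivAt.comp z h0).const_add (b t)
    have h4 := (h2.inner ℝ h1).const_mul (1 / 2 : ℝ)
    refine (h3.add h4).congr_fderiv ?_
    ext v
    simp [hHa, real_inner_comm]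
    rw [inner_sub_right, inner_sub_right, hA (ι v) (ι z), hA (ι v) (ι x), real_inner_comm (A (ι z)), real_inner_comm (A (ι x))]
    ring
  have e2 : xgrad ψ (t, x) = p := by
    unfold xgrad
    rw [e0]
    apply HasGradientAt.gradient
    rw [hasGradientAt_iff_hasFDerivAt]
    refine (hd x).congr_fderiv ?_
    ext v
    simp
  have e3 : xhess ψ (t, x) = (fun j k =>
      ⟪A (J (0, EuclideanSpace.single j 1)), J (0, EuclideanSpace.single k 1)⟫) := by
    unfold xhess
    funext j k
    rw [e0, iteratedFDeriv_two_apply]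
    have : fderiv ℝ (fun z => b t + ⟪p, z - x⟫ +
      1 / 2 * ⟪A (ι (z - x)), ι (z - x)⟫) = fun z => innerSL ℝ p + H (z - x) :=
      funext fun z => (hd z).fderiv
    rw [this]
    have h5 : HasFDerivAt (fun z => innerSL ℝ p + H (z - x)) H x := by
      have h0 : HasFDerivAt (fun z : Euc N => z - x) (ContinuousLinearMap.id ℝ _) x :=
        (hasFDerivAt_id x).sub_const x
      exact (H.hasFDerivAt.comp x h0).const_add _
    rw [h5.fderiv]
    simp [hHa, hιa]
  rw [e1, e2, e3] at key
  simpa using key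

lemma visc_apply' {N : ℕ} {E : Type*} [NormedAddCommGroup E] [InnerProductSpace ℝ E]
    (J : ℝ × Euc N →L[ℝ] E) {A : E →L[ℝ] E} (hA : ∀ v w, ⟪A v, w⟫ = ⟪A w, v⟫) {P : E} {p : Euc N}
    (hp : ∀ ξ, ⟪P, J (0, ξ)⟫ = ⟪p, ξ⟫) {b : ℝ → ℝ} (hb : ContDiff ℝ 2 b) {b' : ℝ} {T : ℝ}
    {G : ℝ → Euc N → ℝ → Euc N → Matrix (Fin N) (Fin N) ℝ → ℝ} {u : ℝ × Euc N → ℝ}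
    (hsub : IsViscSubsolFull T G u)
    (hGcont : ContinuousOn
      (fun z : ℝ × Euc N × ℝ × Euc N × Matrix (Fin N) (Fin N) ℝ =>
        G z.1 z.2.1 z.2.2.1 z.2.2.2.1 z.2.2.2.2)
      {z | z.1 ∈ Set.Icc (0 : ℝ) T})
    {t : ℝ} {x : Euc N} (ht : t ∈ Ioo 0 T)
    (hb' : HasDerivAt b b' t)
    (h : ∀ η : ℝ, 0 < η → ∀ᶠ q in 𝓝 (t, x), u q - b q.1 ≤ u (t, x) - b t + ⟪P, J (q - (t, x))⟫ +
      1 / 2 * ⟪A (J (q - (t, x))), J (q - (t, x))⟫ + η * ‖J (q - (t, x))‖ ^ 2) :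
    b' + ⟪P, J (1, 0)⟫ ≤ G t x (u (t, x)) p
      (fun j k => ⟪A (J (0, EuclideanSpace.single j 1)), J (0, EuclideanSpace.single k 1)⟫) := by
  set X : ℝ → Matrix (Fin N) (Fin N) ℝ := fun η j k =>
    ⟪(A + (2 * η) • ContinuousLinearMap.id ℝ E) (J (0, EuclideanSpace.single j 1)),
      J (0, EuclideanSpace.single k 1)⟫ with hX
  have hXc : Continuous X := by
    refine continuous_matrix fun j k => ?_
    simp only [hX, add_apply, smul_apply, ContinuousLinearMap.id_apply]
    fun_prop
  have hX0 : X 0 = (fun j k => ⟪A (J (0, EuclideanSpace.single j 1)), J (0, EuclideanSpace.single k 1)⟫) := by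
    funext j k
    simp [hX]
  have h1 : ∀ η : ℝ, 0 < η → b' + ⟪P, J (1, 0)⟫ ≤ G t x (u (t, x)) p (X η) := by
    intro η hη
    refine visc_apply J (A := A + (2 * η) • ContinuousLinearMap.id ℝ E) ?_ hp hb hsub ht hb' ?_
    · intro v w
      simp only [add_apply, smul_apply, ContinuousLinearMap.id_apply,
        inner_add_left, inner_smul_left, hA v w, real_inner_comm v w]
    · filter_upwards [h η hη] with q hq
      refine hq.trans (le_of_eq ?_)
      simp only [add_apply, smul_apply, ContinuousLinearMap.id_apply,
        inner_add_left, inner_smul_left, real_inner_self_eq_norm_sq, conj_trivial]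
      ring
  have h2 : Tendsto (fun η => G t x (u (t, x)) p (X η)) (𝓝[>] 0) (𝓝 (G t x (u (t, x)) p (X 0))) := by
    have hz : ((t, x, u (t, x), p, X 0) : ℝ × Euc N × ℝ × Euc N × Matrix (Fin N) (Fin N) ℝ) ∈
      {z : ℝ × Euc N × ℝ × Euc N × Matrix (Fin N) (Fin N) ℝ | z.1 ∈ Set.Icc (0 : ℝ) T} := ⟨ht.1.le, ht.2.le⟩
    have h3 := (hGcont _ hz).tendsto
    have h4 : Tendsto (fun η => ((t, x, u (t, x), p, X η) : ℝ × Euc N × ℝ × Euc N × Matrix (Fin N) (Fin N) ℝ))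
        (𝓝[>] 0) (𝓝[{z | z.1 ∈ Set.Icc (0 : ℝ) T}] (t, x, u (t, x), p, X 0)) := by
      refine tendsto_nhdsWithin_iff.2 ⟨?_, Eventually.of_forall fun η => ⟨ht.1.le, ht.2.le⟩⟩
      apply Tendsto.mono_left _ nhdsWithin_le_nhds
      exact (by fun_prop : Continuous fun η => ((t, x, u (t, x), p, X η) : ℝ × Euc N × ℝ × Euc N × Matrix (Fin N) (Fin N) ℝ)).tendsto 0
    exact h3.comp h4
  rw [hX0] at h2
  refine ge_of_tendsto h2 ?_
  filter_upwards [self_mem_nhdsWithin] with η hη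
  exact h1 η hη

end Apply
end PartD

section PartF
section Scaled
open Real Set Filter Topology
open scoped RealInnerProductSpace NNReal

theorem scaled_lemma (N : ℕ) {ι : Type*} [Fintype ι] [Nonempty ι]
    {β : ι → ℝ} (hβ : ∀ i, 0 < β i) {ε : ℝ} (hε : 0 < ε) :
    ∃ Λ : ℝ, ∀ κ : ℝ, 0 < κ → ∀ (S : Set (ℝ × Euc N)) (U : ι → ℝ × Euc N → ℝ),
      IsCompact S → S.Nonempty →
      (∀ i, UpperSemicontinuousOn (U i) S) → ∀ σ : ℝ, 0 < σ →
      ∃ (s : ℝ) (y : Euc N) (q : ι → ℝ × Euc N) (a : ι → ℝ) (X : ι → Matrix (Fin N) (Fin N) ℝ)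
        (D : ι → ℝ),
        (∀ i, q i ∈ S) ∧ (∀ i, (X i).IsSymm) ∧ (∀ i j k, |X i j k| ≤ Λ) ∧
        (-(∑ i, β i • X i)).PosSemidef ∧
        (|∑ i, β i * a i| ≤ σ / κ) ∧
        (‖∑ i, β i • ((1 / ε) • ((q i).2 - y))‖ ≤ σ) ∧
        (∀ i, 0 ≤ D i) ∧ (∀ i, |(q i).1 - s| ≤ κ * D i) ∧ (∀ i, ‖(q i).2 - y‖ ≤ D i) ∧
        (∀ q' ∈ S, ∑ i, β i * U i q' + ∑ i, β i * (D i ^ 2 / (4 * ε)) ≤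
          ∑ i, β i * U i (q i) + σ) ∧
        (∀ i, ∀ (T : ℝ) (G : ℝ → Euc N → ℝ → Euc N → Matrix (Fin N) (Fin N) ℝ → ℝ)
          (u : ℝ × Euc N → ℝ) (b : ℝ → ℝ) (b' : ℝ), IsViscSubsolFull T G u →
          ContinuousOn (fun z : ℝ × Euc N × ℝ × Euc N × Matrix (Fin N) (Fin N) ℝ =>
            G z.1 z.2.1 z.2.2.1 z.2.2.2.1 z.2.2.2.2) {z | z.1 ∈ Set.Icc (0 : ℝ) T} →
          ContDiff ℝ 2 b → HasDerivAt b b' (q i).1 → (q i).1 ∈ Ioo 0 T → S ∈ 𝓝 (q i) →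
          (∀ q', U i q' = u q' - b q'.1) →
          b' + a i ≤ G (q i).1 (q i).2 (u (q i)) ((1 / ε) • ((q i).2 - y)) (X i)) := by
  obtain ⟨Λ, hΛ⟩ := sum_lemma' (E := WithLp 2 (ℝ × Euc N)) hβ hε
  refine ⟨Λ, fun κ hκ S U hS hne hU σ hσ => ?_⟩
  set e := (WithLp.prodContinuousLinearEquiv 2 ℝ ℝ (Euc N)) with he
  set J : ℝ × Euc N →L[ℝ] WithLp 2 (ℝ × Euc N) := (e.symm : (ℝ × Euc N) →L[ℝ] _).comp
    ((κ⁻¹ • ContinuousLinearMap.fst ℝ ℝ (Euc N)).prod (ContinuousLinearMap.snd ℝ ℝ (Euc N))) with hJ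
  set L : WithLp 2 (ℝ × Euc N) →L[ℝ] ℝ × Euc N :=
    ((κ • ContinuousLinearMap.fst ℝ ℝ (Euc N)).prod (ContinuousLinearMap.snd ℝ ℝ (Euc N))).comp
      (e : _ →L[ℝ] (ℝ × Euc N)) with hL
  have hJa : ∀ t x, J (t, x) = WithLp.toLp 2 (κ⁻¹ * t, x) := fun t x => rfl
  have hLa : ∀ z, L z = (κ * z.fst, z.snd) := fun z => rfl
  have hLJ : ∀ q, L (J q) = q := by
    rintro ⟨t, x⟩
    rw [hJa, hLa]
    simp [hκ.ne']
  have hJL : ∀ z, J (L z) = z := by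
    intro z
    rw [hLa, hJa]
    simp only [inv_mul_cancel_left₀ hκ.ne']
    rfl
  have hUsc : ∀ i, UpperSemicontinuousOn (fun z => U i (L z)) (J '' S) := by
    rintro i _ ⟨q, hq, rfl⟩ c hc
    simp only [hLJ] at hc
    have h1 := hU i q hq c hc
    have h2 : Tendsto L (𝓝[J '' S] (J q)) (𝓝[S] q) := by
      refine tendsto_nhdsWithin_iff.2 ⟨?_, ?_⟩
      · have := L.continuous.tendsto (J q)
        rw [hLJ] at this
        exact this.mono_left nhdsWithin_le_nhds
      · filter_upwards [self_mem_nhdsWithin] with z hz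
        obtain ⟨q', hq', rfl⟩ := hz
        rwa [hLJ]
    exact h2.eventually h1
  obtain ⟨y, x, A, h1, h2, h3, h4, h5, h6, h7⟩ := hΛ (J '' S) (fun i z => U i (L z))
    (hS.image J.continuous) (hne.image _) hUsc σ hσ
  set es : Fin N → Euc N := fun j => EuclideanSpace.single j 1 with hes
  have hJe : ∀ ξ : Euc N, ‖J (0, ξ)‖ = ‖ξ‖ := by
    intro ξ
    rw [hJa, mul_zero]
    have := WithLp.prod_norm_sq_eq_of_L2 (WithLp.toLp 2 ((0:ℝ), ξ))
    have h0 : ‖WithLp.toLp 2 ((0:ℝ), ξ)‖ ^ 2 = ‖ξ‖ ^ 2 := by rw [this]; simp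
    exact (sq_eq_sq₀ (norm_nonneg _) (norm_nonneg _)).1 h0
  have hinner : ∀ (z : WithLp 2 (ℝ × Euc N)) t ξ, ⟪z, J (t, ξ)⟫ = κ⁻¹ * t * z.fst + ⟪z.snd, ξ⟫ := by
    intro z t ξ
    rw [hJa, WithLp.prod_inner_apply]
    simp
  have hfn : ∀ z : WithLp 2 (ℝ × Euc N), |z.fst| ≤ ‖z‖ := fun z => by
    have := WithLp.prod_norm_sq_eq_of_L2 z
    apply abs_le_of_sq_le_sq _ (norm_nonneg z)
    have : ‖z.fst‖ ^ 2 = z.fst ^ 2 := by simp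
    nlinarith [sq_nonneg ‖z.snd‖]
  have hsn : ∀ z : WithLp 2 (ℝ × Euc N), ‖z.snd‖ ≤ ‖z‖ := fun z => by
    have := WithLp.prod_norm_sq_eq_of_L2 z
    apply le_of_sq_le_sq _ (norm_nonneg z)
    nlinarith [sq_nonneg ‖z.fst‖]
  obtain ⟨X, hX⟩ : ∃ X : ι → Matrix (Fin N) (Fin N) ℝ, ∀ i j k,
      X i j k = ⟪A i (J (0, es j)), J (0, es k)⟫ :=
    ⟨fun i => Matrix.of fun j k => ⟪A i (J (0, es j)), J (0, es k)⟫, fun i j k => rfl⟩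
  refine ⟨(L y).1, (L y).2, fun i => L (x i), fun i => κ⁻¹ * ((1 / ε) • (x i - y)).fst,
    X, fun i => ‖x i - y‖, ?_, ?_, ?_, ?_, ?_, ?_, ?_, ?_,
    ?_, ?_, ?_⟩
  · intro i
    obtain ⟨q, hq, hqx⟩ := h1 i
    show L (x i) ∈ S
    rw [← hqx, hLJ]; exact hq
  · intro i
    ext j k
    rw [Matrix.transpose_apply, hX, hX]
    exact h2 i _ _
  · intro i j k
    rw [hX]
    refine (abs_real_inner_le_norm _ _).trans ?_
    have a1 := (A i).le_opNorm (J (0, es j))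
    rw [hJe] at a1 ⊢
    simp [hes] at a1 ⊢
    exact a1.trans (h3 i)
  · refine Matrix.PosSemidef.of_dotProduct_mulVec_nonneg ?_ ?_
    · ext j k
      simp only [Matrix.conjTranspose_apply, Matrix.neg_apply, Matrix.sum_apply, Matrix.smul_apply,
        star_trivial]
      congr 1
      refine Finset.sum_congr rfl fun i _ => ?_
      rw [hX, hX, h2 i]
    · intro v
      set ξ : Euc N := WithLp.toLp 2 v with hξ
      have hxi0 : ((0, ξ) : ℝ × Euc N) = ∑ j, v j • ((0, es j) : ℝ × Euc N) := by
        apply Prod.ext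
        · simp [Prod.fst_sum]
        · rw [Prod.snd_sum]
          ext l
          simp [hes, hξ, Pi.single_apply]
      have hxi : J (0, ξ) = ∑ j, v j • J (0, es j) := by
        rw [hxi0, map_sum]
        simp only [map_smul]
      have h8 := h4 (J (0, ξ))
      have h9 : ∀ i, ⟪A i (J (0, ξ)), J (0, ξ)⟫ =
          ∑ j, ∑ k, v j * (⟪A i (J (0, es j)), J (0, es k)⟫ * v k) := by
        intro i
        rw [hxi, map_sum, sum_inner]
        refine Finset.sum_congr rfl fun j _ => ?_
        rw [inner_sum]
        refine Finset.sum_congr rfl fun k _ => ?_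
        rw [map_smul, inner_smul_left, inner_smul_right]
        simp only [conj_trivial]
        ring
      have h10 : star v ⬝ᵥ (-(∑ i, β i • X i)).mulVec v = -∑ i, β i * ⟪A i (J (0, ξ)), J (0, ξ)⟫ := by
        simp only [h9, Matrix.neg_mulVec, dotProduct_neg, Matrix.sum_mulVec, Matrix.smul_mulVec,
          dotProduct_sum, dotProduct_smul, smul_eq_mul]
        congr 1
        refine Finset.sum_congr rfl fun i _ => ?_
        congr 1
        simp only [dotProduct, Matrix.mulVec, Finset.mul_sum, Pi.star_apply, star_trivial, hX]
      exact h10.symm ▸ (by linarith)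
  · have e1 : ∑ i, β i * (κ⁻¹ * ((1 / ε) • (x i - y)).fst) =
        κ⁻¹ * (∑ i, β i • ((1 / ε) • (x i - y))).fst := by
      have e2 : ∀ z : WithLp 2 (ℝ × Euc N), z.fst =
        ((ContinuousLinearMap.fst ℝ ℝ (Euc N)).comp (e : _ →L[ℝ] (ℝ × Euc N))) z := fun z => rfl
      rw [e2 (∑ i, β i • ((1 / ε) • (x i - y))), map_sum, Finset.mul_sum]
      refine Finset.sum_congr rfl fun i _ => ?_
      rw [map_smul, ← e2, smul_eq_mul]
      ring
    rw [e1, abs_mul, abs_of_pos (inv_pos.2 hκ), div_eq_inv_mul σ κ]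
    exact mul_le_mul_of_nonneg_left ((hfn _).trans h5) (inv_pos.2 hκ).le
  · have e1 : ∑ i, β i • ((1 / ε) • ((L (x i)).2 - (L y).2)) =
        (∑ i, β i • ((1 / ε) • (x i - y))).snd := by
      have e2 : ∀ z : WithLp 2 (ℝ × Euc N), z.snd =
        ((ContinuousLinearMap.snd ℝ ℝ (Euc N)).comp (e : _ →L[ℝ] (ℝ × Euc N))) z := fun z => rfl
      rw [e2 (∑ i, β i • ((1 / ε) • (x i - y))), map_sum]
      refine Finset.sum_congr rfl fun i _ => ?_
      rw [map_smul, map_smul, map_sub, ← e2, ← e2]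
      rfl
    rw [e1]
    exact (hsn _).trans h5
  · intro i; exact norm_nonneg _
  · intro i
    have e1 : (L (x i)).1 - (L y).1 = κ * (x i - y).fst := by
      simp [hLa, mul_sub]
    rw [e1, abs_mul, abs_of_pos hκ]
    exact mul_le_mul_of_nonneg_left (hfn _) hκ.le
  · intro i
    exact hsn (x i - y)
  · intro q' hq'
    have := h6 (J q') ⟨q', hq', rfl⟩
    simpa only [hLJ] using this
  · intro i T G u b b' hsub hG hb hb' ht hSn hUu
    have hv := visc_apply' (t := (L (x i)).1) (x := (L (x i)).2) J (h2 i) (P := (1 / ε) • (x i - y))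
      (p := (1 / ε) • ((L (x i)).2 - (L y).2)) ?_ hb hsub hG ht hb' ?_
    · rw [hinner] at hv
      have hXi : X i = (fun j k => ⟪A i (J (0, EuclideanSpace.single j 1)),
          J (0, EuclideanSpace.single k 1)⟫) := funext fun j => funext fun k => hX i j k
      rw [hXi]
      simpa using hv
    · intro ξ
      rw [hinner]
      simp [hLa]
    · intro η hη
      have k1 := h7 i η hη
      have k2 : Tendsto J (𝓝 (L (x i))) (𝓝 (x i)) := by
        have := J.continuous.tendsto (L (x i))
        rwa [hJL] at this
      filter_upwards [k2.eventually k1, hSn] with q hq hqS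
      have := hq ⟨q, hqS, rfl⟩
      simp only [hLJ, hUu] at this
      have e1 : J (q - L (x i)) = J q - x i := by rw [map_sub, hJL]
      have e2 : (((L (x i)).1, (L (x i)).2) : ℝ × Euc N) = L (x i) := rfl
      rw [e2, e1]
      exact this
end Scaled
end PartF

section PartH
section Limit
open Real Set Filter Topology
open scoped RealInnerProductSpace NNReal

lemma matrices_compact (N : ℕ) {ι : Type*} [Fintype ι] (Λ : ℝ) :
    IsCompact {X : ι → Matrix (Fin N) (Fin N) ℝ | ∀ i j k, |X i j k| ≤ Λ} := by
  have h : IsCompact (univ.pi fun _ : ι => univ.pi fun _ : Fin N => univ.pi fun _ : Fin N =>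
      Icc (-Λ) Λ) :=
    isCompact_univ_pi fun i => isCompact_univ_pi fun j => isCompact_univ_pi fun k => isCompact_Icc
  have e : {X : ι → Matrix (Fin N) (Fin N) ℝ | ∀ i j k, |X i j k| ≤ Λ} =
      (univ.pi fun _ : ι => univ.pi fun _ : Fin N => univ.pi fun _ : Fin N => Icc (-Λ) Λ) := by
    ext X
    simp only [mem_setOf_eq, Set.mem_pi, mem_univ, true_imp_iff, mem_Icc, abs_le]
    exact ⟨fun h i _ j _ k _ => h i j k, fun h i j k => h i trivial j trivial k trivial⟩
  rw [e]
  exact h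

theorem limit_lemma {N : ℕ} {ι : Type*} [Fintype ι] [Nonempty ι]
    {β : ι → ℝ} (hβ : ∀ i, 0 < β i) {ε : ℝ} (hε : 0 < ε) {T : ℝ}
    {G : ι → ℝ → Euc N → ℝ → Euc N → Matrix (Fin N) (Fin N) ℝ → ℝ}
    {u : ι → ℝ × Euc N → ℝ}
    (hsub : ∀ i, IsViscSubsolFull T (G i) (u i))
    (hGcont : ∀ i, ContinuousOn
      (fun z : ℝ × Euc N × ℝ × Euc N × Matrix (Fin N) (Fin N) ℝ =>
        G i z.1 z.2.1 z.2.2.1 z.2.2.2.1 z.2.2.2.2)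
      {z | z.1 ∈ Set.Icc (0 : ℝ) T})
    {S : Set (ℝ × Euc N)} (hS : IsCompact S)
    {b : ℝ → ℝ} (hb : ContDiff ℝ 2 b) {c : ℝ} (hbc : ∀ t, 0 ≤ t → c ≤ deriv b t)
    (hU : ∀ i, UpperSemicontinuousOn (fun q => u i q - b q.1) S)
    {q0 : ℝ × Euc N} (hq0 : q0 ∈ S) {M μ ρ σ K V t1 : ℝ}
    (hM : ∑ i, β i * (u i q0 - b q0.1) = M) (hμ : 0 < μ) (hρ : 0 < ρ)
    (hK : ∀ Q : ι → ℝ × Euc N, (∀ i, Q i ∈ S) → ∑ i, β i * (u i (Q i) - b (Q i).1) ≤ M + K)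
    (hεs : ∀ i, (K + 1) * (4 * ε) < β i * (ρ / 2) ^ 2)
    (hV : ∀ Q : ι → ℝ × Euc N, (∀ i, Q i ∈ S) → M - μ ≤ ∑ i, β i * (u i (Q i) - b (Q i).1) →
      ∀ i, |u i (Q i)| ≤ V)
    (hint : ∀ Q : ι → ℝ × Euc N, (∀ i, Q i ∈ S) → (∀ i j, dist (Q i) (Q j) < ρ) →
      M - μ ≤ ∑ i, β i * (u i (Q i) - b (Q i).1) →
      ∀ i, t1 ≤ (Q i).1 ∧ (Q i).1 ∈ Ioo 0 T ∧ S ∈ 𝓝 (Q i))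
    (hσ : ∀ Q : ι → ℝ × Euc N, (∀ i, Q i ∈ S) → (∀ i j, dist (Q i) (Q j) < ρ) →
      ∑ i, β i * (u i (Q i) - b (Q i).1) ≤ M + σ) :
    ∃ (t : ℝ) (y : Euc N) (x : ι → Euc N) (v : ι → ℝ) (X : ι → Matrix (Fin N) (Fin N) ℝ),
      t1 ≤ t ∧ (∀ i, (t, x i) ∈ S) ∧ (∀ i, |v i| ≤ V) ∧ (∀ i, (X i).IsSymm) ∧
      (-(∑ i, β i • X i)).PosSemidef ∧ ∑ i, β i • ((1 / ε) • (x i - y)) = 0 ∧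
      (∀ i, ‖x i - y‖ ≤ ρ / 2) ∧
      ∑ i, β i * (‖x i - y‖ ^ 2 / (4 * ε)) ≤ σ ∧ M ≤ ∑ i, β i * (v i - b t) ∧
      (∑ i, β i) * c ≤ ∑ i, β i * G i t (x i) (v i) ((1 / ε) • (x i - y)) (X i) := by
  obtain ⟨Λ, hΛ⟩ := scaled_lemma N hβ hε
  set κ : ℕ → ℝ := fun n => min 1 μ * (1 / ((n : ℝ) + 1)) with hκ
  have hm : 0 < min 1 μ := lt_min one_pos hμ
  have hκ0 : ∀ n, 0 < κ n := fun n => by simp only [hκ]; positivity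
  have hκm : ∀ n, κ n ≤ min 1 μ := fun n => by
    have h1 : 1 / ((n : ℝ) + 1) ≤ 1 := by
      rw [div_le_one (by positivity)]; linarith [(Nat.cast_nonneg n : (0:ℝ) ≤ n)]
    have := mul_le_mul_of_nonneg_left h1 hm.le
    simpa [hκ] using this
  have hκ1 : ∀ n, κ n ≤ 1 := fun n => (hκm n).trans (min_le_left _ _)
  have hκμ : ∀ n, κ n ^ 2 ≤ μ := fun n => by
    have := (hκm n).trans (min_le_right _ _)
    nlinarith [hκ1 n, hκ0 n]
  have hκt : Tendsto κ atTop (𝓝 0) := by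
    have := (tendsto_one_div_add_atTop_nhds_zero_nat (𝕜 := ℝ)).const_mul (min 1 μ)
    simpa [hκ] using this
  choose s y q a X D h1 h2 h3 h4 h5 h6 h7 h8 h9 h10 h11 using fun n => hΛ (κ n) (hκ0 n) S
    (fun i q => u i q - b q.1) hS ⟨q0, hq0⟩ hU (κ n ^ 2) (by have := hκ0 n; positivity)
  have hpen : ∀ n, M + ∑ i, β i * (D n i ^ 2 / (4 * ε)) ≤
      ∑ i, β i * (u i (q n i) - b (q n i).1) + κ n ^ 2 := fun n => by
    have := h10 n q0 hq0
    rwa [hM] at this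
  have hpen0 : ∀ n, 0 ≤ ∑ i, β i * (D n i ^ 2 / (4 * ε)) := fun n =>
    Finset.sum_nonneg fun i _ => by have := hβ i; positivity
  have hD : ∀ n i, D n i < ρ / 2 := by
    intro n i
    have e1 : β i * (D n i ^ 2 / (4 * ε)) ≤ ∑ i, β i * (D n i ^ 2 / (4 * ε)) :=
      Finset.single_le_sum (f := fun i => β i * (D n i ^ 2 / (4 * ε)))
        (fun i _ => by have := hβ i; positivity) (Finset.mem_univ i)
    have e2 := hK (q n) (h1 n)
    have e3 := hpen n
    have e4 : κ n ^ 2 ≤ 1 := by nlinarith [hκ1 n, hκ0 n]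
    have e5 : β i * (D n i ^ 2 / (4 * ε)) ≤ K + 1 := by linarith
    have e6 : β i * (D n i ^ 2 / (4 * ε)) = β i * D n i ^ 2 / (4 * ε) := by ring
    rw [e6, div_le_iff₀ (by positivity)] at e5
    have e7 := e5.trans_lt (hεs i)
    have e8 := lt_of_mul_lt_mul_left e7 (hβ i).le
    exact lt_of_pow_lt_pow_left₀ 2 (by positivity) e8
  have hq1 : ∀ n i, |(q n i).1 - s n| < ρ / 2 := fun n i => by
    refine (h8 n i).trans_lt (lt_of_le_of_lt ?_ (hD n i))
    nlinarith [h7 n i, hκ1 n]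
  have hdist : ∀ n i j, dist (q n i) (q n j) < ρ := by
    intro n i j
    rw [Prod.dist_eq]
    apply max_lt
    · rw [Real.dist_eq]
      have a1 := abs_lt.1 (hq1 n i)
      have a2 := abs_lt.1 (hq1 n j)
      rw [abs_lt]
      constructor <;> linarith
    · have a1 := (h9 n i).trans_lt (hD n i)
      have a2 := (h9 n j).trans_lt (hD n j)
      rw [← dist_eq_norm] at a1 a2
      have := dist_triangle_right (q n i).2 (q n j).2 (y n)
      linarith
  have hlow : ∀ n, M - κ n ^ 2 ≤ ∑ i, β i * (u i (q n i) - b (q n i).1) := fun n => by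
    linarith [hpen n, hpen0 n]
  have hlow' : ∀ n, M - μ ≤ ∑ i, β i * (u i (q n i) - b (q n i).1) := fun n => by
    linarith [hlow n, hκμ n]
  have hint' := fun n => hint (q n) (h1 n) (hdist n) (hlow' n)
  have hσ' := fun n => hσ (q n) (h1 n) (hdist n)
  have hV' := fun n => hV (q n) (h1 n) (hlow' n)
  have hG' : ∀ n, (∑ i, β i) * c - κ n ≤
      ∑ i, β i * G i (q n i).1 (q n i).2 (u i (q n i)) ((1 / ε) • ((q n i).2 - y n)) (X n i) := by
    intro n
    have e1 : ∀ i, c + a n i ≤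
        G i (q n i).1 (q n i).2 (u i (q n i)) ((1 / ε) • ((q n i).2 - y n)) (X n i) := by
      intro i
      obtain ⟨_, g2, g3⟩ := hint' n i
      have hd : HasDerivAt b (deriv b (q n i).1) (q n i).1 :=
        (hb.differentiable (by norm_num)).differentiableAt.hasDerivAt
      have := h11 n i T (G i) (u i) b _ (hsub i) (hGcont i) hb hd g2 g3 (fun _ => rfl)
      linarith [hbc _ g2.1.le]
    have e2 := Finset.sum_le_sum fun i (_ : i ∈ Finset.univ) =>
      mul_le_mul_of_nonneg_left (e1 i) (hβ i).le
    refine le_trans ?_ e2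
    simp only [mul_add, Finset.sum_add_distrib, ← Finset.sum_mul]
    have e3 := (abs_le.1 (h5 n)).1
    have e4 : κ n ^ 2 / κ n = κ n := by
      have := (hκ0 n).ne'
      field_simp
    rw [e4] at e3
    linarith
  obtain ⟨R0, hR0⟩ := hS.isBounded.exists_norm_le
  obtain ⟨i0⟩ := ‹Nonempty ι›
  have hKc : IsCompact ((Icc (-(R0 + ρ)) (R0 + ρ)) ×ˢ (Metric.closedBall (0 : Euc N) (R0 + ρ)) ×ˢ
      (univ.pi fun _ : ι => S) ×ˢ (univ.pi fun _ : ι => Icc (-V) V) ×ˢ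
      {X : ι → Matrix (Fin N) (Fin N) ℝ | ∀ i j k, |X i j k| ≤ Λ}) :=
    isCompact_Icc.prod ((isCompact_closedBall _ _).prod ((isCompact_univ_pi fun _ => hS).prod
      ((isCompact_univ_pi fun _ => isCompact_Icc).prod (matrices_compact N Λ))))
  have hmem : ∀ n, ((s n, y n, q n, (fun i => u i (q n i)), X n) :
      ℝ × Euc N × (ι → ℝ × Euc N) × (ι → ℝ) × (ι → Matrix (Fin N) (Fin N) ℝ)) ∈
      ((Icc (-(R0 + ρ)) (R0 + ρ)) ×ˢ (Metric.closedBall (0 : Euc N) (R0 + ρ)) ×ˢ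
      (univ.pi fun _ : ι => S) ×ˢ (univ.pi fun _ : ι => Icc (-V) V) ×ˢ
      {X : ι → Matrix (Fin N) (Fin N) ℝ | ∀ i j k, |X i j k| ≤ Λ}) := by
    intro n
    have b0 := hR0 _ (h1 n i0)
    have b1 : |(q n i0).1| ≤ R0 := (norm_fst_le (q n i0)).trans b0
    have b2 : ‖(q n i0).2‖ ≤ R0 := (norm_snd_le (q n i0)).trans b0
    refine ⟨?_, ?_, fun i _ => h1 n i, fun i _ => abs_le.1 (hV' n i), h3 n⟩
    · have a1 := abs_lt.1 (hq1 n i0)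
      have a2 := abs_le.1 b1
      constructor <;> simp only <;> linarith
    · rw [mem_closedBall_zero_iff]
      have a1 := (h9 n i0).trans_lt (hD n i0)
      have a2 := norm_sub_norm_le (y n) (q n i0).2
      rw [norm_sub_rev] at a2
      simp only
      linarith
  haveI : FirstCountableTopology (Matrix (Fin N) (Fin N) ℝ) :=
    inferInstanceAs (FirstCountableTopology (Fin N → Fin N → ℝ))
  obtain ⟨z, -, φ, hφ, hz⟩ := hKc.tendsto_subseq hmem
  obtain ⟨s', y', q', v', X'⟩ := z
  have hκφ : Tendsto (fun n => κ (φ n)) atTop (𝓝 0) := hκt.comp hφ.tendsto_atTop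
  have ts : Tendsto (fun n => s (φ n)) atTop (𝓝 s') := ((continuous_fst).tendsto _).comp hz
  have ty : Tendsto (fun n => y (φ n)) atTop (𝓝 y') :=
    ((continuous_fst.comp continuous_snd).tendsto _).comp hz
  have tq : Tendsto (fun n => q (φ n)) atTop (𝓝 q') :=
    ((continuous_fst.comp (continuous_snd.comp continuous_snd)).tendsto _).comp hz
  have tv : Tendsto (fun n i => u i (q (φ n) i)) atTop (𝓝 v') :=
    ((continuous_fst.comp (continuous_snd.comp (continuous_snd.comp continuous_snd))).tendsto _).comp hz
  have tX : Tendsto (fun n => X (φ n)) atTop (𝓝 X') :=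
    ((continuous_snd.comp (continuous_snd.comp (continuous_snd.comp continuous_snd))).tendsto _).comp hz
  rw [tendsto_pi_nhds] at tq tv tX
  have tq1 : ∀ i, Tendsto (fun n => (q (φ n) i).1) atTop (𝓝 (q' i).1) := fun i =>
    (continuous_fst.tendsto _).comp (tq i)
  have tq2 : ∀ i, Tendsto (fun n => (q (φ n) i).2) atTop (𝓝 (q' i).2) := fun i =>
    (continuous_snd.tendsto _).comp (tq i)
  have tqy : ∀ i, Tendsto (fun n => (q (φ n) i).2 - y (φ n)) atTop (𝓝 ((q' i).2 - y')) := fun i =>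
    (tq2 i).sub ty
  have hqs : ∀ i, (q' i).1 = s' := by
    intro i
    have e1 : Tendsto (fun n => |(q (φ n) i).1 - s (φ n)|) atTop (𝓝 |(q' i).1 - s'|) :=
      ((tq1 i).sub ts).abs
    have e2 : Tendsto (fun n => κ (φ n) * (ρ / 2)) atTop (𝓝 (0 * (ρ / 2))) := hκφ.mul_const _
    rw [zero_mul] at e2
    have e3 := le_of_tendsto_of_tendsto' e1 e2 (fun n => (h8 (φ n) i).trans
      (mul_le_mul_of_nonneg_left (hD _ i).le (hκ0 _).le))
    exact sub_eq_zero.1 (abs_eq_zero.1 (le_antisymm e3 (abs_nonneg _)))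
  have hqS : ∀ i, q' i ∈ S := fun i =>
    hS.isClosed.mem_of_tendsto (tq i) (Eventually.of_forall fun n => h1 _ i)
  have hq' : ∀ i, q' i = (s', (q' i).2) := fun i => by rw [← hqs i]
  have tκ2 : Tendsto (fun n => κ (φ n) ^ 2) atTop (𝓝 0) := by
    have := hκφ.pow 2
    simpa using this
  refine ⟨s', y', fun i => (q' i).2, v', X', ?_, ?_, ?_, ?_, ?_, ?_, ?_, ?_, ?_, ?_⟩
  · rw [← hqs i0]
    exact ge_of_tendsto' (tq1 i0) fun n => (hint' (φ n) i0).1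
  · intro i
    rw [← hq' i]; exact hqS i
  · intro i
    exact le_of_tendsto' (tv i).abs fun n => hV' (φ n) i
  · intro i
    have e1 : Tendsto (fun n => (X (φ n) i).transpose) atTop (𝓝 (X' i).transpose) :=
      ((continuous_id.matrix_transpose).tendsto _).comp (tX i)
    exact tendsto_nhds_unique e1 ((tX i).congr fun n => (h2 (φ n) i).symm)
  · have e1 : Tendsto (fun n => -(∑ i, β i • X (φ n) i)) atTop (𝓝 (-(∑ i, β i • X' i))) :=
      (tendsto_finsetSum _ fun i _ => (tX i).const_smul (β i)).neg
    refine Matrix.PosSemidef.of_dotProduct_mulVec_nonneg ?_ ?_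
    · have e2 := ((continuous_id.matrix_conjTranspose).tendsto _).comp e1
      exact tendsto_nhds_unique e2 (e1.congr fun n => (h4 (φ n)).1.symm)
    · intro v
      have hc : Continuous fun A : Matrix (Fin N) (Fin N) ℝ => star v ⬝ᵥ A.mulVec v := by fun_prop
      exact ge_of_tendsto' ((hc.tendsto _).comp e1) fun n => (h4 (φ n)).dotProduct_mulVec_nonneg v
  · have e1 : Tendsto (fun n => ‖∑ i, β i • ((1 / ε) • ((q (φ n) i).2 - y (φ n)))‖) atTop
        (𝓝 ‖∑ i, β i • ((1 / ε) • ((q' i).2 - y'))‖) :=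
      (tendsto_finsetSum _ fun i _ => ((tqy i).const_smul (1 / ε)).const_smul (β i)).norm
    have e3 := le_of_tendsto_of_tendsto' e1 tκ2 (fun n => h6 (φ n))
    exact norm_eq_zero.1 (le_antisymm e3 (norm_nonneg _))
  · intro i
    exact le_of_tendsto' (tqy i).norm fun n => (h9 (φ n) i).trans (hD (φ n) i).le
  · have e1 : Tendsto (fun n => ∑ i, β i * (‖(q (φ n) i).2 - y (φ n)‖ ^ 2 / (4 * ε))) atTop
        (𝓝 (∑ i, β i * (‖(q' i).2 - y'‖ ^ 2 / (4 * ε)))) :=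
      tendsto_finsetSum _ fun i _ => (((tqy i).norm.pow 2).div_const _).const_mul _
    have e2 : Tendsto (fun n => σ + κ (φ n) ^ 2) atTop (𝓝 (σ + 0)) := tκ2.const_add σ
    rw [add_zero] at e2
    refine le_of_tendsto_of_tendsto' e1 e2 fun n => ?_
    have e3 : ∑ i, β i * (‖(q (φ n) i).2 - y (φ n)‖ ^ 2 / (4 * ε)) ≤
        ∑ i, β i * (D (φ n) i ^ 2 / (4 * ε)) := by
      refine Finset.sum_le_sum fun i _ => ?_
      have := hβ i
      have := h9 (φ n) i
      gcongr
    linarith [hpen (φ n), hσ' (φ n)]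
  · have e1 : Tendsto (fun n => ∑ i, β i * (u i (q (φ n) i) - b (q (φ n) i).1)) atTop
        (𝓝 (∑ i, β i * (v' i - b (q' i).1))) :=
      tendsto_finsetSum _ fun i _ => ((tv i).sub
        ((hb.continuous.tendsto _).comp (tq1 i))).const_mul _
    simp only [hqs] at e1
    have e2 : Tendsto (fun n => M - κ (φ n) ^ 2) atTop (𝓝 (M - 0)) := tκ2.const_sub M
    rw [sub_zero] at e2
    exact le_of_tendsto_of_tendsto' e2 e1 fun n => hlow (φ n)
  · have e1 : Tendsto (fun n => ∑ i, β i * G i (q (φ n) i).1 (q (φ n) i).2 (u i (q (φ n) i))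
          ((1 / ε) • ((q (φ n) i).2 - y (φ n))) (X (φ n) i)) atTop
        (𝓝 (∑ i, β i * G i s' (q' i).2 (v' i) ((1 / ε) • ((q' i).2 - y')) (X' i))) := by
      refine tendsto_finsetSum _ fun i _ => Tendsto.const_mul _ ?_
      have g1 : Tendsto (fun n => (((q (φ n) i).1, (q (φ n) i).2, u i (q (φ n) i),
          (1 / ε) • ((q (φ n) i).2 - y (φ n)), X (φ n) i) :
          ℝ × Euc N × ℝ × Euc N × Matrix (Fin N) (Fin N) ℝ)) atTop
          (𝓝 (s', (q' i).2, v' i, (1 / ε) • ((q' i).2 - y'), X' i)) := by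
        have := tq1 i
        rw [hqs i] at this
        exact this.prodMk_nhds ((tq2 i).prodMk_nhds ((tv i).prodMk_nhds
          (((tqy i).const_smul (1 / ε)).prodMk_nhds (tX i))))
      have g0 : ∀ n, (q (φ n) i).1 ∈ Icc 0 T := fun n => Ioo_subset_Icc_self (hint' (φ n) i).2.1
      have g2 : s' ∈ Icc 0 T := by
        rw [← hqs i]
        exact isClosed_Icc.mem_of_tendsto (tq1 i) (Eventually.of_forall g0)
      have g3 := (hGcont i (s', (q' i).2, v' i, (1 / ε) • ((q' i).2 - y'), X' i) g2).tendsto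
      exact g3.comp (tendsto_nhdsWithin_iff.2 ⟨g1, Eventually.of_forall g0⟩)
    have e2 : Tendsto (fun n => (∑ i, β i) * c - κ (φ n)) atTop (𝓝 ((∑ i, β i) * c - 0)) :=
      hκφ.const_sub _
    rw [sub_zero] at e2
    exact le_of_tendsto_of_tendsto' e2 e1 fun n => hG' (φ n)
end Limit
end PartH

set_option maxHeartbeats 4000000

/-- Domination theorem for viscosity subsolutions of
`∂ₜuᵢ − Gᵢ(t, x, uᵢ, Duᵢ, D²uᵢ) = 0`. -/
theorem stmt_15 {N k : ℕ} (T : ℝ) (hT : 0 < T)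
    (G : Fin k → ℝ → Euc N → ℝ → Euc N → Matrix (Fin N) (Fin N) ℝ → ℝ)
    (β : Fin k → ℝ) (hβ : ∀ i, 0 < β i)
    (u : Fin k → ℝ × Euc N → ℝ)
    (husc : ∀ i, UpperSemicontinuousOn (u i)
      (Set.Icc (0 : ℝ) T ×ˢ (Set.univ : Set (Euc N))))
    (hsub : ∀ i, IsViscSubsolFull T (G i) (u i))
    (hdecay : ∀ ε > (0 : ℝ), ∃ R : ℝ, ∀ t ∈ Set.Icc (0 : ℝ) T, ∀ x : Euc N,
      R ≤ ‖x‖ → max (∑ i, β i * u i (t, x)) 0 ≤ ε)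
    (hGcont : ∀ i, ContinuousOn
      (fun z : ℝ × Euc N × ℝ × Euc N × Matrix (Fin N) (Fin N) ℝ =>
        G i z.1 z.2.1 z.2.2.1 z.2.2.2.1 z.2.2.2.2)
      {z | z.1 ∈ Set.Icc (0 : ℝ) T})
    (hmod : ∃ w wb : ℝ → ℝ, Continuous w ∧ Continuous wb ∧ w 0 = 0 ∧
      (∀ r, 0 ≤ w r) ∧ (∀ r, 0 ≤ wb r) ∧
      ∀ i, ∀ t ∈ Set.Ico (0 : ℝ) T, ∀ x y : Euc N, ∀ v : ℝ, ∀ p : Euc N,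
        ∀ A : Matrix (Fin N) (Fin N) ℝ, A.IsSymm →
        max (-(G i t x v p A - G i t y v p A)) 0 ≤
          wb (1 + (T - t)⁻¹ + ‖x‖ + ‖y‖ + |v|) * w (‖x - y‖ + ‖p‖ * ‖x - y‖))
    (hdom : ∀ t ∈ Set.Ioo (0 : ℝ) T, ∀ x : Euc N,
      ∀ v : Fin k → ℝ, ∀ p : Fin k → Euc N, ∀ A : Fin k → Matrix (Fin N) (Fin N) ℝ,
      (∀ i, (A i).IsSymm) → 0 ≤ ∑ i, β i * v i → ∑ i, β i • p i = 0 →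
      (-(∑ i, β i • A i)).PosSemidef →
      ∑ i, β i * G i t x (v i) (p i) (A i) ≤ 0)
    (hinit_cont : Continuous (fun x : Euc N => ∑ i, β i * u i (0, x)))
    (hinit_nonpos : ∀ x : Euc N, ∑ i, β i * u i (0, x) ≤ 0) :
    ∀ t ∈ Set.Ioo (0 : ℝ) T, ∀ x : Euc N, ∑ i, β i * u i (t, x) ≤ 0 := by
  by_contra hcon
  push Not at hcon
  obtain ⟨t0, ht0, x0, hpos⟩ := hcon
  set m0 : ℝ := ∑ i, β i * u i (t0, x0) with hm0
  haveI hne : Nonempty (Fin k) := by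
    by_contra h
    rw [not_nonempty_iff] at h
    simp [hm0] at hpos
  obtain ⟨w, wb, hw, hwb, hw0, hwn, hwbn, hmod⟩ := hmod
  set B : ℝ := ∑ i, β i with hB
  have hBpos : 0 < B := Finset.sum_pos (fun i _ => hβ i) Finset.univ_nonempty
  obtain ⟨R0, hR0⟩ := hdecay (m0 / 8) (by positivity)
  set R : ℝ := max (max R0 ‖x0‖) 0 + 1 with hR
  have hRR0 : R0 ≤ R := by
    have h1 := le_max_left R0 ‖x0‖
    have h2 := le_max_left (max R0 ‖x0‖) 0
    linarith
  have hRx0 : ‖x0‖ ≤ R := by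
    have h1 := le_max_right R0 ‖x0‖
    have h2 := le_max_left (max R0 ‖x0‖) 0
    linarith
  have hRpos : 0 < R := by
    have h2 := le_max_right (max R0 ‖x0‖) 0
    linarith
  obtain ⟨ht00, ht0T⟩ := ht0
  set T' : ℝ := (t0 + T) / 2 with hT'
  have hT'T : T' < T := by rw [hT']; linarith
  have ht0T' : t0 < T' := by rw [hT']; linarith
  set τ : ℝ := (t0 + T') / 2 with hτ
  set d : ℝ := (T' - t0) / 2 with hd
  have hdpos : 0 < d := by rw [hd]; linarith
  set S : Set (ℝ × Euc N) := Icc 0 T' ×ˢ Metric.closedBall 0 R with hS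
  have hSc : IsCompact S := isCompact_Icc.prod (isCompact_closedBall _ _)
  have hSsub : S ⊆ Icc (0 : ℝ) T ×ˢ (univ : Set (Euc N)) := by
    rintro ⟨t, x⟩ ⟨h1, h2⟩
    exact ⟨⟨h1.1, h1.2.trans hT'T.le⟩, trivial⟩
  have huS : ∀ i, UpperSemicontinuousOn (u i) S := fun i => (husc i).mono hSsub
  have hC : ∀ i, ∃ C, ∀ q ∈ S, u i q ≤ C := fun i => by
    obtain ⟨C, hC⟩ := (huS i).bddAbove_of_isCompact hSc
    exact ⟨C, fun q hq => hC ⟨q, hq, rfl⟩⟩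
  choose C0 hC0 using hC
  set C : ℝ := ∑ i, |C0 i| + 1 with hC
  have hC1 : 1 ≤ C := by
    have : 0 ≤ ∑ i, |C0 i| := Finset.sum_nonneg fun i _ => abs_nonneg _
    linarith
  have huC : ∀ i, ∀ q ∈ S, u i q ≤ C := fun i q hq => by
    have h1 : |C0 i| ≤ ∑ i, |C0 i| :=
      Finset.single_le_sum (f := fun i => |C0 i|) (fun i _ => abs_nonneg _) (Finset.mem_univ i)
    have := hC0 i q hq
    have := le_abs_self (C0 i)
    linarith
  set K : ℝ := 2 * B / m0 + C with hK
  have hKpos : 0 < K := by positivity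
  set l : ℝ := K / d with hl
  have hlpos : 0 < l := by positivity
  have hld : l * d = K := by rw [hl]; field_simp
  set b : ℝ → ℝ := fun t => Real.exp (l * (t - τ)) with hb
  have hbpos : ∀ t, 0 < b t := fun t => Real.exp_pos _
  have hexpK : K ≤ Real.exp K := by have := Real.add_one_le_exp K; linarith
  have hbT' : K ≤ b T' := by
    have : l * (T' - τ) = K := by rw [← hld, hd, hτ]; ring
    simp only [hb, this]; exact hexpK
  have hbt0 : B * b t0 ≤ m0 / 2 := by
    have h1 : l * (t0 - τ) = -K := by rw [← hld, hd, hτ]; ring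
    simp only [hb, h1, Real.exp_neg]
    have h2 : 2 * B / m0 ≤ Real.exp K := by linarith
    rw [div_le_iff₀ hpos] at h2
    rw [← div_eq_mul_inv, div_le_iff₀ (Real.exp_pos _)]
    linarith
  have hbC : ContDiff ℝ 2 b := by
    simp only [hb]
    exact Real.contDiff_exp.comp (contDiff_const.mul (contDiff_id.sub contDiff_const))
  set c : ℝ := l * Real.exp (-(l * τ)) with hc
  have hcpos : 0 < c := by positivity
  have hbc : ∀ t, 0 ≤ t → c ≤ deriv b t := by
    intro t ht
    have h1 : HasDerivAt (fun t : ℝ => l * (t - τ)) (l * 1) t :=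
      ((hasDerivAt_id t).sub_const τ).const_mul l
    have h2 : HasDerivAt b (Real.exp (l * (t - τ)) * (l * 1)) t := h1.exp
    rw [h2.deriv, hc, mul_one, mul_comm]
    refine mul_le_mul_of_nonneg_right (Real.exp_le_exp.2 ?_) hlpos.le
    nlinarith [mul_nonneg hlpos.le ht]
  have hbcont : Continuous b := hbC.continuous
  have hUS : ∀ i, UpperSemicontinuousOn (fun q => u i q - b q.1) S := fun i => by
    have h1 : ContinuousOn (fun q : ℝ × Euc N => -b q.1) S :=
      (hbcont.comp continuous_fst).neg.continuousOn
    have := (huS i).add h1.upperSemicontinuousOn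
    simpa only [sub_eq_add_neg] using this
  have hsumS : UpperSemicontinuousOn (fun q => ∑ i, β i * (u i q - b q.1)) S := by
    refine upperSemicontinuousOn_sum fun i _ => ?_
    exact (continuous_const_mul (β i)).comp_upperSemicontinuousOn (hUS i)
      (fun x y hxy => mul_le_mul_of_nonneg_left hxy (hβ i).le)
  have hq00 : ((t0, x0) : ℝ × Euc N) ∈ S :=
    ⟨⟨ht00.le, ht0T'.le⟩, by simpa using hRx0⟩
  obtain ⟨q0, hq0, hq0max⟩ := hsumS.exists_isMaxOn ⟨_, hq00⟩ hSc
  set M : ℝ := ∑ i, β i * (u i q0 - b q0.1) with hM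
  have hMmax : ∀ q ∈ S, ∑ i, β i * (u i q - b q.1) ≤ M := fun q hq => hq0max hq
  have hsplit : ∀ (v : Fin k → ℝ) (s : ℝ), ∑ i, β i * (v i - s) = ∑ i, β i * v i - B * s := by
    intro v s
    simp only [mul_sub, Finset.sum_sub_distrib, ← Finset.sum_mul]
    rfl
  have hMm : m0 / 2 ≤ M := by
    have h1 := hMmax _ hq00
    rw [hsplit (fun i => u i (t0, x0)) (b t0)] at h1
    linarith
  -- upper bound for arbitrary points
  have hKS : ∀ Q : Fin k → ℝ × Euc N, (∀ i, Q i ∈ S) →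
      ∑ i, β i * (u i (Q i) - b (Q i).1) ≤ M + B * C := by
    intro Q hQ
    have h1 : ∑ i, β i * (u i (Q i) - b (Q i).1) ≤ ∑ i, β i * C :=
      Finset.sum_le_sum fun i _ => mul_le_mul_of_nonneg_left
        (by linarith [huC i _ (hQ i), hbpos (Q i).1]) (hβ i).le
    rw [← Finset.sum_mul] at h1
    linarith
  -- the parabolic boundary of the cylinder
  set D : Set (ℝ × Euc N) := S ∩ ({q | q.1 = 0} ∪ {q | q.1 = T'} ∪ {q | ‖q.2‖ = R}) with hD
  have hDc : IsCompact D := by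
    refine hSc.inter_right (IsClosed.union (IsClosed.union ?_ ?_) ?_)
    · exact isClosed_eq continuous_fst continuous_const
    · exact isClosed_eq continuous_fst continuous_const
    · exact isClosed_eq continuous_snd.norm continuous_const
  have hDm : ∀ q ∈ D, ∑ i, β i * (u i q - b q.1) ≤ m0 / 8 := by
    rintro ⟨t, x⟩ ⟨hqS, hq⟩
    rw [hsplit (fun i => u i (t, x)) (b t)]
    have hbt : 0 < B * b t := mul_pos hBpos (hbpos t)
    rcases hq with (hq | hq) | hq
    · simp only [mem_setOf_eq] at hq
      subst hq
      have := hinit_nonpos x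
      linarith
    · simp only [mem_setOf_eq] at hq
      rw [← hq] at hbT'
      have h1 : ∑ i, β i * u i (t, x) ≤ ∑ i, β i * C :=
        Finset.sum_le_sum fun i _ => mul_le_mul_of_nonneg_left (huC i _ hqS) (hβ i).le
      rw [← Finset.sum_mul] at h1
      have h2 : C ≤ K := by
        have : 0 < 2 * B / m0 := by positivity
        linarith
      have h3 : B * C ≤ B * b t := mul_le_mul_of_nonneg_left (h2.trans hbT') hBpos.le
      linarith
    · simp only [mem_setOf_eq] at hq
      have h1 := hR0 t (hSsub hqS).1 x (by rw [hq]; exact hRR0)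
      have h2 := le_max_left (∑ i, β i * u i (t, x)) 0
      linarith
  obtain ⟨ρ1, hρ1, hρ1D⟩ := usc_diag hβ hDc inter_subset_left hUS hDm
    (σ := m0 / 8) (by positivity)
  -- minimum of the weights
  obtain ⟨β0, hβ0, hβ0le⟩ : ∃ β0 > 0, ∀ i, β0 ≤ β i := by
    obtain ⟨i, -, hi⟩ := Finset.exists_min_image Finset.univ β Finset.univ_nonempty
    exact ⟨β i, hβ i, fun j => hi j (Finset.mem_univ j)⟩
  -- bound on values
  set V : ℝ := C + B * C / β0 with hV
  have hVb : ∀ Q : Fin k → ℝ × Euc N, (∀ i, Q i ∈ S) →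
      M - m0 / 4 ≤ ∑ i, β i * (u i (Q i) - b (Q i).1) → ∀ i, |u i (Q i)| ≤ V := by
    intro Q hQ hlow i
    have hBC : 0 ≤ B * C / β0 := by positivity
    rw [abs_le]
    refine ⟨?_, by linarith [huC i _ (hQ i)]⟩
    have h1 : ∑ j, β j * (u j (Q j) - b (Q j).1) ≤
        ∑ j, (β j * C + if j = i then β i * (u i (Q i) - C) else 0) := by
      refine Finset.sum_le_sum fun j _ => ?_
      by_cases hji : j = i
      · subst hji
        simp only [if_true]
        have := mul_pos (hβ j) (hbpos (Q j).1)
        nlinarith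
      · simp only [hji, if_false, add_zero]
        exact mul_le_mul_of_nonneg_left (by linarith [huC j _ (hQ j), hbpos (Q j).1]) (hβ j).le
    rw [Finset.sum_add_distrib, ← Finset.sum_mul, Finset.sum_ite_eq' Finset.univ i] at h1
    simp only [Finset.mem_univ, if_true] at h1
    have h2 : -(B * C) ≤ β i * u i (Q i) := by
      have := mul_pos (hβ i) (by linarith : 0 < C)
      nlinarith
    have h3 : -(B * C / β0) ≤ u i (Q i) := by
      by_contra h
      push Not at h
      have h4 : β0 * (B * C / β0) = B * C := by field_simp
      have h5 : β i * u i (Q i) < β i * (-(B * C / β0)) := mul_lt_mul_of_pos_left h (hβ i)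
      have h6 : β0 * (B * C / β0) ≤ β i * (B * C / β0) :=
        mul_le_mul_of_nonneg_right (hβ0le i) hBC
      linarith
    linarith
  -- moduli
  set L : ℝ := 1 + (T - T')⁻¹ + (R + 1) + R + V with hL
  obtain ⟨W0, hW0⟩ := (isCompact_Icc (a := (0:ℝ)) (b := L)).bddAbove_image hwb.continuousOn
  set W : ℝ := |W0| + 1 with hW
  have hWpos : 0 < W := by positivity
  have hWb : ∀ r, 0 ≤ r → r ≤ L → wb r ≤ W := fun r h1 h2 => by
    have := hW0 ⟨r, ⟨h1, h2⟩, rfl⟩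
    have := le_abs_self W0
    linarith
  obtain ⟨δ, hδ, hwδ⟩ : ∃ δ > 0, ∀ r, 0 ≤ r → r < δ → w r ≤ c / (2 * W) := by
    have h1 : ∀ᶠ r in nhds (0:ℝ), w r < c / (2 * W) :=
      hw.continuousAt.eventually_lt continuousAt_const (by rw [hw0]; positivity)
    rw [Metric.eventually_nhds_iff] at h1
    obtain ⟨δ, hδ, h⟩ := h1
    refine ⟨δ, hδ, fun r hr hrδ => (h ?_).le⟩
    rw [Real.dist_eq, sub_zero, abs_of_nonneg hr]
    exact hrδ
  set σ : ℝ := β0 * δ / 16 with hσ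
  have hσpos : 0 < σ := by positivity
  obtain ⟨ρ2, hρ2, hρ2S⟩ := usc_diag hβ hSc Subset.rfl hUS hMmax hσpos
  set ρ : ℝ := min (ρ1 / 2) (min ρ2 (min δ 1)) with hρ
  have hρpos : 0 < ρ := lt_min (by positivity) (lt_min hρ2 (lt_min hδ one_pos))
  have hρa : ρ ≤ ρ1 / 2 := min_le_left _ _
  have hρb : ρ ≤ ρ2 := (min_le_right _ _).trans (min_le_left _ _)
  have hρc : ρ ≤ δ := (min_le_right _ _).trans ((min_le_right _ _).trans (min_le_left _ _))
  have hρd : ρ ≤ 1 := (min_le_right _ _).trans ((min_le_right _ _).trans (min_le_right _ _))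
  set ε : ℝ := β0 * (ρ / 2) ^ 2 / (8 * (B * C + 1)) with hε
  have hBC1 : 0 < B * C + 1 := by positivity
  have hεpos : 0 < ε := by positivity
  have hεs : ∀ i, (B * C + 1) * (4 * ε) < β i * (ρ / 2) ^ 2 := by
    intro i
    have h1 : (B * C + 1) * (4 * ε) = β0 * (ρ / 2) ^ 2 / 2 := by
      rw [hε]; field_simp; ring
    have h2 : 0 < β0 * (ρ / 2) ^ 2 := by positivity
    have h3 : β0 * (ρ / 2) ^ 2 ≤ β i * (ρ / 2) ^ 2 :=
      mul_le_mul_of_nonneg_right (hβ0le i) (by positivity)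
    linarith
  have hint : ∀ Q : Fin k → ℝ × Euc N, (∀ i, Q i ∈ S) → (∀ i j, dist (Q i) (Q j) < ρ) →
      M - m0 / 4 ≤ ∑ i, β i * (u i (Q i) - b (Q i).1) →
      ∀ i, ρ1 / 2 ≤ (Q i).1 ∧ (Q i).1 ∈ Ioo 0 T ∧ S ∈ nhds (Q i) := by
    intro Q hQ hQd hlow i
    have hnot : ∀ q ∈ D, ¬ ∀ j, dist (Q j) q < ρ1 := fun q hq h => by
      have := hρ1D q hq Q hQ h
      linarith
    have hQi := hQ i
    have hnD : Q i ∉ D := fun h => hnot _ h fun j => (hQd j i).trans_le (by linarith)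
    have ha : ρ1 / 2 ≤ (Q i).1 := by
      by_contra h
      push Not at h
      refine hnot (0, (Q i).2) ⟨⟨⟨le_rfl, by linarith⟩, hQi.2⟩, Or.inl (Or.inl rfl)⟩ fun j => ?_
      have h1 : dist (Q i) (0, (Q i).2) < ρ1 / 2 := by
        rw [Prod.dist_eq]
        apply max_lt
        · simp only [Real.dist_eq, sub_zero, abs_of_nonneg hQi.1.1]; exact h
        · simp only [dist_self]; positivity
      have h2 := dist_triangle (Q j) (Q i) (0, (Q i).2)
      have h3 := hQd j i
      linarith
    have hb1 : (Q i).1 < T' := lt_of_le_of_ne hQi.1.2 fun h => hnD ⟨hQi, Or.inl (Or.inr h)⟩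
    have hx1 : ‖(Q i).2‖ ≤ R := by simpa using hQi.2
    have hx2 : ‖(Q i).2‖ < R := lt_of_le_of_ne hx1 fun h => hnD ⟨hQi, Or.inr h⟩
    refine ⟨ha, ⟨by linarith, by linarith⟩, ?_⟩
    refine prod_mem_nhds (Icc_mem_nhds (by linarith) hb1) ?_
    exact Metric.closedBall_mem_nhds_of_mem (by simpa using hx2)
  have hσS : ∀ Q : Fin k → ℝ × Euc N, (∀ i, Q i ∈ S) → (∀ i j, dist (Q i) (Q j) < ρ) →
      ∑ i, β i * (u i (Q i) - b (Q i).1) ≤ M + σ := by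
    intro Q hQ hQd
    obtain ⟨i0⟩ := hne
    exact (hρ2S (Q i0) (hQ i0) Q hQ fun j => (hQd j i0).trans_le hρb).le
  obtain ⟨t, y, x, v, X, h1, h2, h3, h4, h5, h6, h7, h8, h9, h10⟩ :=
    limit_lemma hβ hεpos hsub hGcont hSc hbC hbc hUS hq0 hM.symm
      (by positivity : 0 < m0 / 4) hρpos hKS hεs hVb hint hσS
  obtain ⟨i0⟩ := hne
  have htT' : t ≤ T' := (h2 i0).1.2
  have ht : t ∈ Ioo 0 T := ⟨by linarith, by linarith⟩
  have hv0 : 0 ≤ ∑ i, β i * v i := by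
    rw [hsplit] at h9
    have := mul_pos hBpos (hbpos t)
    linarith
  have hfin := hdom t ht y v (fun i => (1 / ε) • (x i - y)) X h4 hv0 h6 h5
  have hkey : ∀ i, G i t (x i) (v i) ((1 / ε) • (x i - y)) (X i) ≤
      G i t y (v i) ((1 / ε) • (x i - y)) (X i) + c / 2 := by
    intro i
    have g1 := hmod i t ⟨ht.1.le, ht.2⟩ y (x i) (v i) ((1 / ε) • (x i - y)) (X i) (h4 i)
    have g2 := (le_max_left _ _).trans g1
    have gx : ‖x i‖ ≤ R := by simpa using (h2 i).2
    have gxy := h7 i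
    have gy : ‖y‖ ≤ R + 1 := by
      have := norm_sub_norm_le y (x i)
      rw [norm_sub_rev] at this
      linarith
    have gT : (T - t)⁻¹ ≤ (T - T')⁻¹ := inv_anti₀ (by linarith) (by linarith)
    have gT0 : 0 ≤ (T - t)⁻¹ := inv_nonneg.2 (by linarith [ht.2])
    have g3 : wb (1 + (T - t)⁻¹ + ‖y‖ + ‖x i‖ + |v i|) ≤ W := by
      apply hWb
      · positivity
      · linarith [h3 i]
    have g4 : β i * (‖x i - y‖ ^ 2 / (4 * ε)) ≤ σ :=
      (Finset.single_le_sum (f := fun i => β i * (‖x i - y‖ ^ 2 / (4 * ε)))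
        (fun i _ => by have := hβ i; positivity) (Finset.mem_univ i)).trans h8
    have g5 : β0 * (‖x i - y‖ ^ 2 / (4 * ε)) ≤ β0 * (δ / 16) := by
      refine (mul_le_mul_of_nonneg_right (hβ0le i) (by positivity)).trans (g4.trans_eq ?_)
      rw [hσ]; ring
    have g6 : ‖x i - y‖ ^ 2 / (4 * ε) ≤ δ / 16 := le_of_mul_le_mul_left g5 hβ0
    have g7 : ‖(1 / ε) • (x i - y)‖ * ‖y - x i‖ = 4 * (‖x i - y‖ ^ 2 / (4 * ε)) := by
      rw [norm_smul, norm_sub_rev y, Real.norm_of_nonneg (by positivity)]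
      field_simp
    have g8 : w (‖y - x i‖ + ‖(1 / ε) • (x i - y)‖ * ‖y - x i‖) ≤ c / (2 * W) := by
      apply hwδ
      · positivity
      · rw [g7, norm_sub_rev]
        linarith
    have g9 : wb (1 + (T - t)⁻¹ + ‖y‖ + ‖x i‖ + |v i|) *
        w (‖y - x i‖ + ‖(1 / ε) • (x i - y)‖ * ‖y - x i‖) ≤ W * (c / (2 * W)) :=
      mul_le_mul g3 g8 (hwn _) hWpos.le
    have g10 : W * (c / (2 * W)) = c / 2 := by field_simp
    linarith
  have hsum := Finset.sum_le_sum fun i (_ : i ∈ Finset.univ) =>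
    mul_le_mul_of_nonneg_left (hkey i) (hβ i).le
  simp only [mul_add, Finset.sum_add_distrib, ← Finset.sum_mul] at hsum
  have := mul_pos hBpos hcpos
  linarith
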